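/- arXiv:2210.04376 — 2 statements merged into one kernel-verified Lean document; each statement's English description precedes it below -/
import Mathlib

section
/- Let v₁ and v₂ be bounded solutions of the ODE (O6) with v₁(0) = v₂(0). If either v₁'(0) > v₂'(0) ≥ 0 or v₁'(0) < v₂'(0) ≤ 0, then the (conserved) Hamiltonian energies satisfy H(v₁)(0) > H(v₂)(0). -/
noncomputable section

open Real

def cN (n : ℕ) : ℝ := (n : ℝ) * ((n : ℝ) - 6) * ((n : ℝ) ^ 4 - 20 * (n : ℝ) ^ 2 + 64) / 64
def K0 (n : ℕ) : ℝ := ((n : ℝ) - 6) ^ 2 * ((n : ℝ) - 2) ^ 2 * ((n : ℝ) + 2) ^ 2 / 64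
def K2 (n : ℕ) : ℝ := (3 * (n : ℝ) ^ 4 - 24 * (n : ℝ) ^ 3 + 72 * (n : ℝ) ^ 2 - 96 * (n : ℝ) + 304) / 16
def K4 (n : ℕ) : ℝ := (3 * (n : ℝ) ^ 2 - 12 * (n : ℝ) + 44) / 4

/-- `v` is a (classical, entire) solution of the sixth order ODE (O6). -/
def IsSolO6 (n : ℕ) (v : ℝ → ℝ) : Prop :=
  ContDiff ℝ 6 v ∧ ∀ t : ℝ,
    iteratedDeriv 6 v t - K4 n * iteratedDeriv 4 v t + K2 n * iteratedDeriv 2 v t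
      - K0 n * v t + cN n * |v t| ^ (12 / ((n : ℝ) - 6)) * v t = 0

def cHat (n : ℕ) : ℝ := ((n : ℝ) - 6) ^ 2 * ((n : ℝ) ^ 4 - 20 * (n : ℝ) ^ 2 + 64) / 128

/-- The Hamiltonian energy of `v` at time `t`. -/
def Ham (n : ℕ) (v : ℝ → ℝ) (t : ℝ) : ℝ :=
  iteratedDeriv 5 v t * iteratedDeriv 1 v t - iteratedDeriv 4 v t * iteratedDeriv 2 v t
    + (1 / 2) * (iteratedDeriv 3 v t) ^ 2
    - K4 n * (iteratedDeriv 3 v t * iteratedDeriv 1 v t - (1 / 2) * (iteratedDeriv 2 v t) ^ 2)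
    + (K2 n / 2) * (iteratedDeriv 1 v t) ^ 2 - (K0 n / 2) * (v t) ^ 2
    + cHat n * |v t| ^ (2 * (n : ℝ) / ((n : ℝ) - 6))

namespace SixthOrder

lemma le_of_hasDerivAt_nonneg {f f' : ℝ → ℝ} {a b : ℝ} (hf : ∀ t, HasDerivAt f (f' t) t)
    (hab : a ≤ b) (h : ∀ t ∈ Set.Ioo a b, 0 ≤ f' t) : f a ≤ f b := by
  rcases hab.eq_or_lt with rfl | hlt
  · exact le_rfl
  obtain ⟨c, hc, hc'⟩ := exists_hasDerivAt_eq_slope f f' hlt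
    (fun t _ => (hf t).continuousAt.continuousWithinAt) (fun t _ => hf t)
  have h1 := h c hc
  rw [hc', div_nonneg_iff] at h1
  rcases h1 with h1 | h1 <;> linarith [h1.1, h1.2]

lemma lt_of_hasDerivAt_pos {f f' : ℝ → ℝ} {a b : ℝ} (hf : ∀ t, HasDerivAt f (f' t) t)
    (hab : a < b) (h : ∀ t ∈ Set.Ioo a b, 0 < f' t) : f a < f b := by
  obtain ⟨c, hc, hc'⟩ := exists_hasDerivAt_eq_slope f f' hab
    (fun t _ => (hf t).continuousAt.continuousWithinAt) (fun t _ => hf t)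
  have h1 := h c hc
  rw [hc', div_pos_iff] at h1
  rcases h1 with h1 | h1 <;> linarith [h1.1, h1.2]

lemma exists_pos_right {f : ℝ → ℝ} {a c : ℝ} (hf : HasDerivAt f c a) (h0 : f a = 0) (hc : 0 < c) :
    ∃ δ > 0, ∀ t ∈ Set.Ioo a (a + δ), 0 < f t := by
  have h := hf.tendsto_slope
  have h2 : ∀ᶠ t in nhdsWithin a {a}ᶜ, 0 < slope f a t := h.eventually (lt_mem_nhds hc)
  rw [eventually_nhdsWithin_iff, Metric.eventually_nhds_iff] at h2
  obtain ⟨δ, hδ, h3⟩ := h2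
  refine ⟨δ, hδ, fun t ht => ?_⟩
  have h4 := h3 (y := t) (by rw [Real.dist_eq, abs_lt]; constructor <;> linarith [ht.1, ht.2])
    (by simpa using ht.1.ne')
  rw [slope_def_field, h0, sub_zero] at h4
  exact (div_pos_iff_of_pos_right (sub_pos.2 ht.1)).1 h4

lemma exists_pos_right_of_pos {f : ℝ → ℝ} {a : ℝ} (hf : Continuous f) (h0 : 0 < f a) :
    ∃ δ > 0, ∀ t ∈ Set.Ioo a (a + δ), 0 < f t := by
  have h2 : ∀ᶠ t in nhds a, 0 < f t := hf.continuousAt.eventually (lt_mem_nhds h0)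
  rw [Metric.eventually_nhds_iff] at h2
  obtain ⟨δ, hδ, h3⟩ := h2
  exact ⟨δ, hδ, fun t ht =>
    h3 (by rw [Real.dist_eq, abs_lt]; constructor <;> linarith [ht.1, ht.2])⟩

lemma continuous_of_hasDerivAt {f f' : ℝ → ℝ} (hf : ∀ t, HasDerivAt f (f' t) t) : Continuous f :=
  continuous_iff_continuousAt.2 fun t => (hf t).continuousAt

/-- Initial value comparison for `ψ'' = l ψ + h` with `h ≥ 0`. -/
lemma nonneg_of_initial {ψ ψ' h : ℝ → ℝ} {l a b : ℝ} (hl : 0 ≤ l)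
    (hψ : ∀ t, HasDerivAt ψ (ψ' t) t) (hψ' : ∀ t, HasDerivAt ψ' (l * ψ t + h t) t)
    (h0 : 0 ≤ ψ a) (h1 : 0 ≤ ψ' a) (hh : ∀ t ∈ Set.Ioo a b, 0 ≤ h t) :
    ∀ t ∈ Set.Icc a b, 0 ≤ ψ t ∧ 0 ≤ ψ' t := by
  set k := √l
  have hk : k * k = l := Real.mul_self_sqrt hl
  have hk0 : 0 ≤ k := Real.sqrt_nonneg l
  have hA : ∀ t, HasDerivAt (fun t => Real.exp (-k * t) * (ψ' t + k * ψ t))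
      (Real.exp (-k * t) * h t) t := by
    intro t
    have e := (((hasDerivAt_id t).const_mul (-k)).exp).mul ((hψ' t).add ((hψ t).const_mul k))
    refine e.congr_deriv ?_
    simp only [id, Pi.add_apply, ← hk]; ring
  have hB : ∀ t, HasDerivAt (fun t => Real.exp (k * t) * ψ t)
      (Real.exp (k * t) * (ψ' t + k * ψ t)) t := by
    intro t
    have e := (((hasDerivAt_id t).const_mul k).exp).mul (hψ t)
    refine e.congr_deriv ?_
    simp only [id]; ring
  have hw : ∀ t ∈ Set.Icc a b, 0 ≤ ψ' t + k * ψ t := by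
    intro t ht
    have := le_of_hasDerivAt_nonneg hA ht.1 fun s hs =>
      mul_nonneg (Real.exp_pos _).le (hh s ⟨hs.1, hs.2.trans_le ht.2⟩)
    have h2 : 0 ≤ Real.exp (-k * a) * (ψ' a + k * ψ a) := by positivity
    exact nonneg_of_mul_nonneg_right (h2.trans this) (Real.exp_pos _)
  have hp : ∀ t ∈ Set.Icc a b, 0 ≤ ψ t := by
    intro t ht
    have := le_of_hasDerivAt_nonneg hB ht.1 fun s hs =>
      mul_nonneg (Real.exp_pos _).le (hw s ⟨hs.1.le, hs.2.le.trans ht.2⟩)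
    have h2 : 0 ≤ Real.exp (k * a) * ψ a := by positivity
    exact nonneg_of_mul_nonneg_right (h2.trans this) (Real.exp_pos _)
  refine fun t ht => ⟨hp t ht, h1.trans (le_of_hasDerivAt_nonneg hψ' ht.1 fun s hs => ?_)⟩
  have := hp s ⟨hs.1.le, hs.2.le.trans ht.2⟩
  have := hh s ⟨hs.1, hs.2.trans_le ht.2⟩
  positivity

lemma pos_of_initial {ψ ψ' h : ℝ → ℝ} {l a b : ℝ} (hl : 0 ≤ l)
    (hψ : ∀ t, HasDerivAt ψ (ψ' t) t) (hψ' : ∀ t, HasDerivAt ψ' (l * ψ t + h t) t)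
    (h0 : 0 ≤ ψ a) (h1 : 0 ≤ ψ' a) (hh : ∀ t ∈ Set.Ioo a b, 0 < h t) :
    ∀ t ∈ Set.Ioo a b, 0 < ψ t := by
  have hp := nonneg_of_initial hl hψ hψ' h0 h1 fun t ht => (hh t ht).le
  have hp' : ∀ t ∈ Set.Ioo a b, 0 < ψ' t := fun t ht =>
    h1.trans_lt (lt_of_hasDerivAt_pos hψ' ht.1 fun s hs =>
      add_pos_of_nonneg_of_pos (mul_nonneg hl (hp s ⟨hs.1.le, (hs.2.trans ht.2).le⟩).1)
        (hh s ⟨hs.1, hs.2.trans ht.2⟩))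
  exact fun t ht => h0.trans_lt (lt_of_hasDerivAt_pos hψ ht.1 fun s hs =>
    hp' s ⟨hs.1, hs.2.trans ht.2⟩)

/-- Maximum principle for `ψ'' = l ψ + h` with `h ≤ 0`. -/
lemma nonneg_of_boundary {ψ ψ' h : ℝ → ℝ} {l a b : ℝ} (hl : 0 < l)
    (hψ : ∀ t, HasDerivAt ψ (ψ' t) t) (hψ' : ∀ t, HasDerivAt ψ' (l * ψ t + h t) t)
    (ha : 0 ≤ ψ a) (hb : 0 ≤ ψ b) (hh : ∀ t ∈ Set.Ioo a b, h t ≤ 0) :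
    ∀ t ∈ Set.Icc a b, 0 ≤ ψ t := by
  intro t ht
  obtain ⟨m, hm, hmin⟩ := isCompact_Icc.exists_isMinOn ⟨t, ht⟩
    (continuous_of_hasDerivAt hψ).continuousOn
  by_contra! hneg
  have hmneg : ψ m < 0 := (hmin ht).trans_lt hneg
  have hma : a < m := lt_of_le_of_ne hm.1 (by rintro rfl; linarith)
  have hmb : m < b := lt_of_le_of_ne hm.2 (by rintro rfl; linarith)
  have hloc : IsLocalMin ψ m := hmin.isLocalMin (Icc_mem_nhds hma hmb)
  have hz : ψ' m = 0 := hloc.hasDerivAt_eq_zero (hψ m)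
  have hh' := hh m ⟨hma, hmb⟩
  obtain ⟨δ, hδ, hpos⟩ := exists_pos_right (hψ' m).neg (by simp [hz]) (by nlinarith)
  set e := min (δ / 2) (b - m)
  have he : 0 < e := lt_min (by linarith) (by linarith)
  have he1 : e ≤ δ / 2 := min_le_left _ _
  have he2 : e ≤ b - m := min_le_right _ _
  have := lt_of_hasDerivAt_pos (fun t => (hψ t).neg) (show m < m + e by linarith)
    (fun s hs => hpos s ⟨hs.1, by linarith [hs.2]⟩)
  have h3 : ψ m ≤ ψ (m + e) := hmin ⟨by linarith, by linarith⟩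
  simp only [Pi.neg_apply] at this
  linarith

lemma false_of_deriv_ge {f f' : ℝ → ℝ} {T c C : ℝ} (hf : ∀ t, HasDerivAt f (f' t) t)
    (hc : 0 < c) (hC : ∀ t, |f t| ≤ C) (h : ∀ t, T ≤ t → c ≤ f' t) : False := by
  have hC0 : 0 ≤ C := (abs_nonneg _).trans (hC 0)
  set L := (2 * C + 1) / c
  have hL : 0 < L := by positivity
  have h1 : ∀ t, HasDerivAt (fun t => f t - c * t) (f' t - c) t := fun t =>
    ((hf t).sub ((hasDerivAt_id t).const_mul c)).congr_deriv (by simp)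
  have h2 := le_of_hasDerivAt_nonneg h1 (show T ≤ T + L by linarith)
    fun t ht => sub_nonneg.2 (h t ht.1.le)
  have h3 : c * L = 2 * C + 1 := by simp only [L]; field_simp
  have h4 := abs_le.1 (hC T)
  have h5 := abs_le.1 (hC (T + L))

  nlinarith

/-- A bounded function whose derivative decreases on a half-line has nonnegative derivative. -/
lemma deriv_nonneg_of_concave {f f' f'' : ℝ → ℝ} {T C : ℝ} (hf : ∀ t, HasDerivAt f (f' t) t)
    (hf' : ∀ t, HasDerivAt f' (f'' t) t) (hC : ∀ t, |f t| ≤ C) (h : ∀ t, T ≤ t → f'' t ≤ 0) :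
    ∀ t, T ≤ t → 0 ≤ f' t := by
  intro t ht
  by_contra! hneg
  refine false_of_deriv_ge (T := t) (fun t => (hf t).neg) (neg_pos.2 hneg)
    (C := C) (fun t => by simpa using hC t) fun s hs => ?_
  have := le_of_hasDerivAt_nonneg (fun t => (hf' t).neg) hs fun r hr =>
    neg_nonneg.2 (h r (ht.trans hr.1.le))
  simpa using this

lemma exists_first_zero {f : ℝ → ℝ} {a T : ℝ} (hf : Continuous f) (ha : 0 < f a) (haT : a ≤ T)
    (hT : f T ≤ 0) : ∃ s, a < s ∧ s ≤ T ∧ f s = 0 ∧ ∀ t ∈ Set.Ico a s, 0 < f t := by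
  set S := Set.Icc a T ∩ f ⁻¹' {0}
  have hne : S.Nonempty := by
    obtain ⟨s, hs, hs'⟩ := intermediate_value_Icc' haT hf.continuousOn ⟨hT, ha.le⟩
    exact ⟨s, hs, hs'⟩
  have hcl : IsClosed S := isClosed_Icc.inter (isClosed_singleton.preimage hf)
  have hbd : BddBelow S := ⟨a, fun s hs => hs.1.1⟩
  have hmem := hcl.csInf_mem hne hbd
  have hz : f (sInf S) = 0 := hmem.2
  refine ⟨sInf S, lt_of_le_of_ne hmem.1.1 fun he => ?_, hmem.1.2, hz, fun t ht => ?_⟩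
  · rw [← he] at hz; linarith
  · by_contra! hneg
    obtain ⟨s, hs, hs'⟩ := intermediate_value_Icc' ht.1 hf.continuousOn ⟨hneg, ha.le⟩
    have := csInf_le hbd (show s ∈ S from ⟨⟨hs.1, by linarith [hs.2, ht.2, hmem.1.2]⟩, hs'⟩)
    linarith [hs.2, ht.2]

/-- The last time before which `f` stays nonnegative. -/
lemma exists_exit {f : ℝ → ℝ} {a s : ℝ} (hf : Continuous f) (ha : 0 ≤ f a) (has : a ≤ s)
    (hs : f s < 0) : ∃ τ, a ≤ τ ∧ τ < s ∧ f τ = 0 ∧ (∀ t ∈ Set.Icc a τ, 0 ≤ f t) ∧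
      ∀ ε > 0, ∃ t ∈ Set.Ioo τ (τ + ε), f t < 0 := by
  set S := {t | a ≤ t ∧ f t < 0}
  have hbd : BddBelow S := ⟨a, fun t ht => ht.1⟩
  have hne : S.Nonempty := ⟨s, has, hs⟩
  have haτ : a ≤ sInf S := le_csInf hne fun t ht => ht.1
  have hlt : ∀ t, a ≤ t → t < sInf S → 0 ≤ f t := by
    intro t h1 h2
    by_contra! h3
    exact absurd (csInf_le hbd (show t ∈ S from ⟨h1, h3⟩)) (not_le.2 h2)
  have hge : 0 ≤ f (sInf S) := by
    by_contra! h3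
    rcases haτ.eq_or_lt with h | h
    · rw [← h] at h3; linarith
    have : ∀ᶠ t in nhds (sInf S), f t < 0 := hf.continuousAt.eventually (gt_mem_nhds h3)
    have h4 : ∀ᶠ t in nhdsWithin (sInf S) (Set.Iio (sInf S)), f t < 0 :=
      this.filter_mono nhdsWithin_le_nhds
    have h5 : ∀ᶠ t in nhdsWithin (sInf S) (Set.Iio (sInf S)), t ∈ Set.Ioo a (sInf S) :=
      Ioo_mem_nhdsLT h
    obtain ⟨t, h6, h7⟩ := (h4.and h5).exists
    linarith [hlt t h7.1.le h7.2]
  have hfreq : ∀ ε > 0, ∃ t ∈ Set.Ioo (sInf S) (sInf S + ε), f t < 0 := by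
    intro ε hε
    obtain ⟨t, ht, h2⟩ := exists_lt_of_csInf_lt hne (show sInf S < sInf S + ε by linarith)
    refine ⟨t, ⟨lt_of_le_of_ne (csInf_le hbd ht) ?_, h2⟩, ht.2⟩
    intro he
    rw [he] at hge
    linarith [ht.2]
  have hle : f (sInf S) ≤ 0 := by
    by_contra! h3
    obtain ⟨δ, hδ, h4⟩ := exists_pos_right_of_pos hf h3
    obtain ⟨t, ht, h5⟩ := hfreq δ hδ
    linarith [h4 t ht]
  refine ⟨sInf S, haτ, lt_of_le_of_ne (csInf_le hbd ⟨has, hs⟩) ?_, le_antisymm hle hge, ?_, hfreq⟩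
  · intro he
    rw [he] at hge
    linarith
  · intro t ht
    rcases ht.2.eq_or_lt with h | h
    · rw [h]; exact hge
    · exact hlt t ht.1 h

/-- A bounded trajectory of the triangular system `x'' = p x + y`, `y'' = q y + z`,
`z'' = r z - g`, where the forcing term `g` has the sign of `x` and is dominated by `x`. -/
structure Chain (p q r M C : ℝ) where
  (x x' y y' z z' g : ℝ → ℝ)
  hx : ∀ t, HasDerivAt x (x' t) t
  hx' : ∀ t, HasDerivAt x' (p * x t + y t) t
  hy : ∀ t, HasDerivAt y (y' t) t
  hy' : ∀ t, HasDerivAt y' (q * y t + z t) t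
  hz : ∀ t, HasDerivAt z (z' t) t
  hz' : ∀ t, HasDerivAt z' (r * z t + -g t) t
  sign : ∀ t, 0 ≤ g t * x t
  lip : ∀ t, |g t| ≤ M * |x t|
  bdX : ∀ t, |x t| ≤ C
  bdX' : ∀ t, |x' t| ≤ C
  bdY : ∀ t, |y t| ≤ C
  bdY' : ∀ t, |y' t| ≤ C
  bdZ : ∀ t, |z t| ≤ C
  bdZ' : ∀ t, |z' t| ≤ C

namespace Chain

variable {p q r M C : ℝ}

def neg (c : Chain p q r M C) : Chain p q r M C where
  x := fun t => -c.x t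
  x' := fun t => -c.x' t
  y := fun t => -c.y t
  y' := fun t => -c.y' t
  z := fun t => -c.z t
  z' := fun t => -c.z' t
  g := fun t => -c.g t
  hx := fun t => (c.hx t).neg
  hx' := fun t => (c.hx' t).neg.congr_deriv (by ring)
  hy := fun t => (c.hy t).neg
  hy' := fun t => (c.hy' t).neg.congr_deriv (by ring)
  hz := fun t => (c.hz t).neg
  hz' := fun t => (c.hz' t).neg.congr_deriv (by ring)
  sign := fun t => by simpa using c.sign t
  lip := fun t => by simpa using c.lip t
  bdX := fun t => by simpa using c.bdX t
  bdX' := fun t => by simpa using c.bdX' t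
  bdY := fun t => by simpa using c.bdY t
  bdY' := fun t => by simpa using c.bdY' t
  bdZ := fun t => by simpa using c.bdZ t
  bdZ' := fun t => by simpa using c.bdZ' t

lemma _root_.SixthOrder.hasDerivAt_reflect {f : ℝ → ℝ} {a : ℝ} {t : ℝ} (h : HasDerivAt f a (-t)) :
    HasDerivAt (fun s => f (-s)) (-a) t :=
  (h.comp t (hasDerivAt_neg t)).congr_deriv (by ring)

def rev (c : Chain p q r M C) : Chain p q r M C where
  x := fun t => c.x (-t)
  x' := fun t => -c.x' (-t)
  y := fun t => c.y (-t)
  y' := fun t => -c.y' (-t)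
  z := fun t => c.z (-t)
  z' := fun t => -c.z' (-t)
  g := fun t => c.g (-t)
  hx := fun t => hasDerivAt_reflect (c.hx _)
  hx' := fun t => (hasDerivAt_reflect (c.hx' _)).neg.congr_deriv (by ring)
  hy := fun t => hasDerivAt_reflect (c.hy _)
  hy' := fun t => (hasDerivAt_reflect (c.hy' _)).neg.congr_deriv (by ring)
  hz := fun t => hasDerivAt_reflect (c.hz _)
  hz' := fun t => (hasDerivAt_reflect (c.hz' _)).neg.congr_deriv (by ring)
  sign := fun t => c.sign _
  lip := fun t => c.lip _
  bdX := fun t => c.bdX _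
  bdX' := fun t => by simpa using c.bdX' _
  bdY := fun t => c.bdY _
  bdY' := fun t => by simpa using c.bdY' _
  bdZ := fun t => c.bdZ _
  bdZ' := fun t => by simpa using c.bdZ' _

lemma g_nonneg (c : Chain p q r M C) {t : ℝ} (h : 0 ≤ c.x t) : 0 ≤ c.g t := by
  rcases h.eq_or_lt with h | h
  · have := c.lip t
    rw [← h, abs_zero, mul_zero] at this
    rw [abs_eq_zero.1 (le_antisymm this (abs_nonneg _))]
  · exact nonneg_of_mul_nonneg_left (c.sign t) h

/-- Once `y` becomes negative on a stretch where `x ≥ 0`, it keeps decreasing. -/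
lemma descent (c : Chain p q r M C) (hq : 0 < q) {t₀ t₁ s : ℝ}
    (hz : ∀ s ∈ Set.Icc t₀ t₁, c.y s < 0 → ∀ t ∈ Set.Icc s t₁, c.z t ≤ 0)
    (hy : 0 ≤ c.y t₀ ∨ (c.y t₀ ≤ 0 ∧ c.y' t₀ ≤ 0)) (hs : s ∈ Set.Icc t₀ t₁) (hys : c.y s < 0) :
    ∃ τ ∈ Set.Icc t₀ s, (0 ≤ c.y t₀ → c.y τ = 0) ∧ (∀ t ∈ Set.Ico t₀ τ, 0 ≤ c.y t) ∧
      ∀ t ∈ Set.Icc τ t₁, c.y t ≤ 0 ∧ c.y' t ≤ 0 ∧ c.z t ≤ 0 := by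
  have fin : ∀ τ, t₀ ≤ τ → c.y τ ≤ 0 → c.y' τ ≤ 0 → (∀ t ∈ Set.Icc τ t₁, c.z t ≤ 0) →
      ∀ t ∈ Set.Icc τ t₁, c.y t ≤ 0 ∧ c.y' t ≤ 0 ∧ c.z t ≤ 0 := by
    intro τ _ h1 h2 h3 t ht
    have := nonneg_of_initial hq.le c.neg.hy c.neg.hy' (a := τ) (b := t₁)
      (neg_nonneg.2 h1) (neg_nonneg.2 h2) (fun u hu => neg_nonneg.2 (h3 u ⟨hu.1.le, hu.2.le⟩)) t ht
    exact ⟨neg_nonneg.1 this.1, neg_nonneg.1 this.2, h3 t ht⟩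
  rcases le_or_gt 0 (c.y t₀) with h0 | h0
  · obtain ⟨τ, h1, h2, h3, h4, h5⟩ := exists_exit (continuous_of_hasDerivAt c.hy) h0 hs.1 hys
    have hz1 : ∀ t ∈ Set.Ioc τ t₁, c.z t ≤ 0 := by
      intro t ht
      obtain ⟨u, hu, hyu⟩ := h5 (t - τ) (sub_pos.2 ht.1)
      have hut : u < t := by linarith [hu.2]
      exact hz u ⟨h1.trans hu.1.le, hut.le.trans ht.2⟩ hyu t ⟨hut.le, ht.2⟩
    refine ⟨τ, ⟨h1, h2.le⟩, fun _ => h3, fun t ht => h4 t ⟨ht.1, ht.2.le⟩, fin τ h1 h3.le ?_ ?_⟩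
    · by_contra! h6
      obtain ⟨δ, hδ, h7⟩ := exists_pos_right (c.hy τ) h3 h6
      obtain ⟨u, hu, hyu⟩ := h5 δ hδ
      linarith [h7 u hu]
    · intro t ht
      rcases ht.1.eq_or_lt with rfl | hlt
      · by_contra! h6
        obtain ⟨δ, hδ, h7⟩ := exists_pos_right_of_pos (continuous_of_hasDerivAt c.hz) h6
        obtain ⟨u, hu1, hu2⟩ := exists_between
          (lt_min (show τ < τ + δ by linarith) (h2.trans_le hs.2))
        linarith [h7 u ⟨hu1, hu2.trans_le (min_le_left _ _)⟩,
          hz1 u ⟨hu1, hu2.le.trans (min_le_right _ _)⟩]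
      · exact hz1 t ⟨hlt, ht.2⟩
  · have hy' : c.y' t₀ ≤ 0 := by
      rcases hy with h | h
      · linarith
      · exact h.2
    exact ⟨t₀, ⟨le_rfl, hs.1⟩, fun h => absurd h0 (not_lt.2 h),
      fun t ht => absurd ht.1 (not_le.2 ht.2),
      fin t₀ le_rfl h0.le hy' (hz t₀ ⟨le_rfl, hs.1.trans hs.2⟩ h0)⟩

/-- Starting configurations on the half-line after `t₀` from which a chain cannot stay bounded. -/
def Start (c : Chain p q r M C) (t₀ : ℝ) : Prop :=
  0 ≤ c.x' t₀ ∧ (∃ δ > 0, ∀ t ∈ Set.Ioo t₀ (t₀ + δ), 0 < c.x t) ∧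
  ((0 ≤ c.y t₀ ∧ 0 ≤ c.y' t₀ ∧ 0 ≤ c.z t₀) ∨
    (c.z t₀ ≤ 0 ∧ c.z' t₀ ≤ 0 ∧ (0 ≤ c.y t₀ ∨ (c.y t₀ ≤ 0 ∧ c.y' t₀ ≤ 0))))

/-- The configuration at the beginning of a lap. -/
def LapStart (c : Chain p q r M C) (t₀ : ℝ) : Prop :=
  c.x t₀ = 0 ∧ 0 < c.x' t₀ ∧ 0 ≤ c.y t₀ ∧ 0 ≤ c.y' t₀ ∧ 0 ≤ c.z t₀

lemma LapStart.start {c : Chain p q r M C} {t₀ : ℝ} (h : c.LapStart t₀) : c.Start t₀ :=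
  ⟨h.2.1.le, exists_pos_right (c.hx t₀) h.1 h.2.1, Or.inl ⟨h.2.2.1, h.2.2.2.1, h.2.2.2.2⟩⟩

/-- Shape of a chain on an interval starting from `Start` on which `x ≥ 0`. -/
lemma Start.z_nonpos {c : Chain p q r M C} (hq : 0 < q) (hr : 0 < r) {t₀ t₁ : ℝ}
    (h : c.Start t₀) (hx : ∀ t ∈ Set.Ioo t₀ t₁, 0 ≤ c.x t) :
    ∀ s ∈ Set.Icc t₀ t₁, c.y s < 0 → ∀ t ∈ Set.Icc s t₁, c.z t ≤ 0 := by
  obtain ⟨-, -, hA | hB⟩ := h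
  · intro s hs hys t ht
    by_contra! hzt
    have h1 := nonneg_of_boundary hr c.hz c.hz' hA.2.2 hzt.le fun u hu =>
      neg_nonpos.2 (c.g_nonneg (hx u ⟨hu.1, hu.2.trans_le ht.2⟩))
    have h2 := nonneg_of_initial hq.le c.hy c.hy' hA.1 hA.2.1 (b := t) fun u hu =>
      h1 u ⟨hu.1.le, hu.2.le⟩
    linarith [(h2 s ⟨hs.1, ht.1⟩).1]
  · intro s hs _ t ht
    have := nonneg_of_initial hr.le c.neg.hz c.neg.hz' (a := t₀) (b := t₁)
      (neg_nonneg.2 hB.1) (neg_nonneg.2 hB.2.1) (fun u hu => by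
        simpa [neg] using c.g_nonneg (hx u hu)) t ⟨hs.1.trans ht.1, ht.2⟩
    exact neg_nonneg.1 this.1

lemma Start.y_or {c : Chain p q r M C} {t₀ : ℝ} (h : c.Start t₀) :
    0 ≤ c.y t₀ ∨ (c.y t₀ ≤ 0 ∧ c.y' t₀ ≤ 0) := by
  obtain ⟨-, -, hA | hB⟩ := h
  · exact Or.inl hA.1
  · exact hB.2.2

/-- As long as `x` and `y` stay nonnegative, `x` increases. -/
lemma mono_of_nonneg (c : Chain p q r M C) (hp : 0 < p) {t₀ t₁ : ℝ} (h : 0 ≤ c.x' t₀)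
    (hx : ∀ t ∈ Set.Ioo t₀ t₁, 0 ≤ c.x t) (hy : ∀ t ∈ Set.Ioo t₀ t₁, 0 ≤ c.y t) :
    (∀ t ∈ Set.Icc t₀ t₁, c.x' t₀ ≤ c.x' t) ∧
      ∀ s ∈ Set.Icc t₀ t₁, ∀ t ∈ Set.Icc s t₁, c.x s ≤ c.x t := by
  have h1 : ∀ t ∈ Set.Icc t₀ t₁, c.x' t₀ ≤ c.x' t := fun t ht =>
    le_of_hasDerivAt_nonneg c.hx' ht.1 fun u hu =>
      add_nonneg (mul_nonneg hp.le (hx u ⟨hu.1, hu.2.trans_le ht.2⟩))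
        (hy u ⟨hu.1, hu.2.trans_le ht.2⟩)
  exact ⟨h1, fun s hs t ht => le_of_hasDerivAt_nonneg c.hx ht.1 fun u hu =>
    h.trans (h1 u ⟨hs.1.trans hu.1.le, hu.2.le.trans ht.2⟩)⟩

lemma Start.exists_zero {c : Chain p q r M C} (hp : 0 < p) (hq : 0 < q) (hr : 0 < r) {t₀ : ℝ}
    (h : c.Start t₀) : ∃ t₁ > t₀, c.x t₁ = 0 ∧ ∀ t ∈ Set.Ioo t₀ t₁, 0 < c.x t := by
  obtain ⟨δ, hδ, hpos⟩ := h.2.1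
  have key : ∃ T, t₀ + δ / 2 ≤ T ∧ c.x T ≤ 0 := by
    by_contra! hT
    have hx : ∀ t, t₀ < t → 0 < c.x t := by
      intro t ht
      rcases lt_or_ge t (t₀ + δ / 2) with h1 | h1
      · exact hpos t ⟨ht, by linarith⟩
      · exact hT t h1
    by_cases hy : ∀ t, t₀ ≤ t → 0 ≤ c.y t
    · have hm := fun t₁ => c.mono_of_nonneg hp (t₁ := t₁) h.1 (fun t ht => (hx t ht.1).le)
        (fun t ht => hy t ht.1.le)
      refine false_of_deriv_ge (T := t₀ + δ / 2) c.hx'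
        (mul_pos hp (hx (t₀ + δ / 2) (by linarith))) c.bdX' fun t ht => ?_
      have h1 := (hm t).2 (t₀ + δ / 2) ⟨by linarith, ht⟩ t ⟨ht, le_rfl⟩
      have h2 := hy t (by linarith)
      nlinarith
    · push Not at hy
      obtain ⟨s, hs, hys⟩ := hy
      refine false_of_deriv_ge (T := s) c.neg.hy' (c := q * -c.y s) (by nlinarith)
        c.neg.bdY' fun t ht => ?_
      have hz := h.z_nonpos hq hr (t₁ := t) fun u hu => (hx u hu.1).le
      obtain ⟨τ, hτ, -, h1, h2⟩ := c.descent hq hz h.y_or ⟨hs, ht⟩ hys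
      have h3 := le_of_hasDerivAt_nonneg c.neg.hy ht fun u hu =>
        neg_nonneg.2 (h2 u ⟨hτ.2.trans hu.1.le, hu.2.le⟩).2.1
      have h4 := (h2 t ⟨hτ.2.trans ht, le_rfl⟩).2.2
      simp only [neg] at h3 ⊢
      nlinarith
  obtain ⟨T, hT1, hT2⟩ := key
  obtain ⟨s, h1, h2, h3, h4⟩ := exists_first_zero (continuous_of_hasDerivAt c.hx)
    (hpos (t₀ + δ / 2) ⟨by linarith, by linarith⟩) hT1 hT2
  refine ⟨s, by linarith, h3, fun t ht => ?_⟩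
  rcases lt_or_ge t (t₀ + δ / 2) with h5 | h5
  · exact hpos t ⟨ht.1, by linarith⟩
  · exact h4 t ⟨h5, ht.2⟩

/-- One lap leads from a start configuration to the opposite lap configuration. -/
lemma Start.lap {c : Chain p q r M C} (hp : 0 < p) (hq : 0 < q) (hr : 0 < r) {t₀ : ℝ}
    (h : c.Start t₀) : ∃ t₁ > t₀, ∃ τ ∈ Set.Icc t₀ t₁, (∀ t ∈ Set.Ioo t₀ t₁, 0 < c.x t) ∧
      (0 ≤ c.y t₀ → c.y τ = 0) ∧ (∀ t ∈ Set.Ico t₀ τ, 0 ≤ c.y t) ∧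
      (∀ t ∈ Set.Icc τ t₁, c.y t ≤ 0 ∧ c.y' t ≤ 0) ∧ c.neg.LapStart t₁ := by
  obtain ⟨t₁, ht₁, hx0, hpos⟩ := h.exists_zero hp hq hr
  have hz := h.z_nonpos hq hr fun u hu => (hpos u hu).le
  have hys : ∃ s ∈ Set.Icc t₀ t₁, c.y s < 0 := by
    by_contra! hy
    have h1 := (c.mono_of_nonneg hp h.1 (fun t ht => (hpos t ht).le)
      fun t ht => hy t ⟨ht.1.le, ht.2.le⟩).2 ((t₀ + t₁) / 2) ⟨by linarith, by linarith⟩ t₁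
      ⟨by linarith, le_rfl⟩
    have h2 := hpos ((t₀ + t₁) / 2) ⟨by linarith, by linarith⟩
    linarith
  obtain ⟨s, hs, hys⟩ := hys
  obtain ⟨τ, hτ, h0, h1, h2⟩ := c.descent hq hz h.y_or hs hys
  have h3 := le_of_hasDerivAt_nonneg c.neg.hy hs.2 fun u hu =>
    neg_nonneg.2 (h2 u ⟨hτ.2.trans hu.1.le, hu.2.le⟩).2.1
  have h4 := h2 t₁ ⟨hτ.2.trans hs.2, le_rfl⟩
  have hy1 : c.y t₁ < 0 := by simp only [neg] at h3; linarith
  refine ⟨t₁, ht₁, τ, ⟨hτ.1, hτ.2.trans hs.2⟩, hpos, h0, h1,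
    fun t ht => ⟨(h2 t ht).1, (h2 t ht).2.1⟩, ?_, ?_, ?_, ?_, ?_⟩
  · simp [neg, hx0]
  · by_contra! h5
    simp only [neg] at h5
    have hx'0 : 0 ≤ c.x' t₁ := by linarith
    -- going backwards from `t₁` the function `x` would become negative
    have hrev : ∃ δ > 0, ∀ t ∈ Set.Ioo (-t₁) (-t₁ + δ), 0 < c.rev.neg.x t := by
      rcases hx'0.eq_or_lt with h6 | h6
      · obtain ⟨δ, hδ, h7⟩ := exists_pos_right (c.rev.neg.hx' (-t₁)) (by simp [neg, rev, ← h6])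
          (by simp [neg, rev, hx0, hy1])
        refine ⟨δ, hδ, fun t ht => ?_⟩
        have := lt_of_hasDerivAt_pos c.rev.neg.hx ht.1 fun s hs => h7 s ⟨hs.1, hs.2.trans ht.2⟩
        simpa [neg, rev, hx0] using this
      · exact exists_pos_right (c.rev.neg.hx (-t₁)) (by simp [neg, rev, hx0])
          (by simp [neg, rev, h6])
    obtain ⟨δ, hδ, h7⟩ := hrev
    have h8 : 0 < min (δ / 2) ((t₁ - t₀) / 2) := lt_min (by linarith) (by linarith)
    have h9 : min (δ / 2) ((t₁ - t₀) / 2) ≤ δ / 2 := min_le_left _ _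
    have h10 : min (δ / 2) ((t₁ - t₀) / 2) ≤ (t₁ - t₀) / 2 := min_le_right _ _
    set e := min (δ / 2) ((t₁ - t₀) / 2)
    have h11 := h7 (-t₁ + e) ⟨by linarith, by linarith⟩
    have h12 := hpos (t₁ - e) ⟨by linarith, by linarith⟩
    simp only [neg, rev, neg_add, neg_neg] at h11
    rw [← sub_eq_add_neg] at h11
    linarith
  · simp only [neg]; linarith
  · simp only [neg]; linarith
  · simp only [neg]; linarith

/-- During a lap the speed `|x'|` at the zeros of `x` grows by a definite amount. -/
lemma LapStart.gain {c : Chain p q r M C} (hp : 0 < p) (hq : 0 < q) (hr : 0 < r) (hC : 0 < C)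
    {t₀ m : ℝ} (h : c.LapStart t₀) (hm : 0 < m) (hmx : m ≤ c.x' t₀) :
    ∃ t₁, c.neg.LapStart t₁ ∧
      c.x' t₀ ^ 2 + m / C * c.y t₀ ^ 2 ≤ c.neg.x' t₁ ^ 2 ∧ m ^ 2 / (4 * C) ≤ c.neg.y t₁ := by
  obtain ⟨t₁, ht₁, τ, hτ, hpos, h0, h1, h2, h3⟩ := h.start.lap hp hq hr
  have hyτ := h0 h.2.2.1
  have hx1 : c.x t₁ = 0 := by simpa [neg] using h3.1
  refine ⟨t₁, h3, ?_, ?_⟩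
  · have hE : ∀ t, HasDerivAt (fun t => c.x' t ^ 2 - p * c.x t ^ 2 + m / C * c.y t ^ 2)
        (2 * c.x' t * c.y t + 2 * (m / C) * (c.y t * c.y' t)) t := fun t =>
      ((((c.hx' t).pow 2).sub (((c.hx t).pow 2).const_mul p)).add
        (((c.hy t).pow 2).const_mul (m / C))).congr_deriv (by simp; ring)
    have hE' : ∀ t, HasDerivAt (fun t => c.x' t ^ 2 - p * c.x t ^ 2 - 2 * (c.x t * c.y t))
        (2 * (c.x t * -c.y' t)) t := fun t =>
      ((((c.hx' t).pow 2).sub (((c.hx t).pow 2).const_mul p)).sub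
        (((c.hx t).mul (c.hy t)).const_mul 2)).congr_deriv (by simp; ring)
    have e1 := le_of_hasDerivAt_nonneg hE hτ.1 fun t ht => by
      have a1 := (c.mono_of_nonneg hp h.2.1.le (t₁ := τ)
        (fun u hu => (hpos u ⟨hu.1, hu.2.trans_le hτ.2⟩).le)
        (fun u hu => h1 u ⟨hu.1.le, hu.2⟩)).1 t ⟨ht.1.le, ht.2.le⟩
      have a2 := h1 t ⟨ht.1.le, ht.2⟩
      have a3 := (abs_le.1 (c.bdY' t)).1
      have a4 : m / C * (c.y t * -C) ≤ m / C * (c.y t * c.y' t) := by gcongr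
      have a5 : m / C * (c.y t * -C) = -(m * c.y t) := by field_simp
      have a6 : m * c.y t ≤ c.x' t * c.y t := by gcongr; exact hmx.trans a1
      linarith
    have e2 := le_of_hasDerivAt_nonneg hE' hτ.2 fun t ht => by
      have a1 := hpos t ⟨hτ.1.trans_lt ht.1, ht.2⟩
      have a2 := (h2 t ⟨ht.1.le, ht.2.le⟩).2
      have : 0 ≤ c.x t * -c.y' t := mul_nonneg a1.le (by linarith)
      linarith
    simp only [hyτ, h.1, hx1] at e1 e2
    simp only [neg]
    nlinarith
  · set η := m ^ 2 / (4 * C) with hη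
    have hη0 : 0 < η := by positivity
    by_contra! h4
    simp only [neg] at h4
    have hy : ∀ t ∈ Set.Icc t₀ t₁, -η ≤ c.y t := by
      intro t ht
      rcases lt_or_ge t τ with h5 | h5
      · linarith [h1 t ⟨ht.1, h5⟩]
      · have := le_of_hasDerivAt_nonneg c.neg.hy ht.2 fun u hu =>
          neg_nonneg.2 (h2 u ⟨h5.trans hu.1.le, hu.2.le⟩).2
        simp only [neg] at this
        linarith
    have hx0 : ∀ t ∈ Set.Ioo t₀ t₁, 0 ≤ p * c.x t := fun t ht => mul_nonneg hp.le (hpos t ht).le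
    have d1 : ∀ t, HasDerivAt (fun t => c.x' t + η * t) (p * c.x t + c.y t + η) t := fun t =>
      ((c.hx' t).add ((hasDerivAt_id t).const_mul η)).congr_deriv (by simp)
    have b1 : ∀ t ∈ Set.Icc t₀ t₁, m - η * (t - t₀) ≤ c.x' t := fun t ht => by
      have := le_of_hasDerivAt_nonneg d1 ht.1 fun u hu => by
        have := hx0 u ⟨hu.1, hu.2.trans_le ht.2⟩
        have := hy u ⟨hu.1.le, hu.2.le.trans ht.2⟩
        linarith
      linarith
    have d2 : ∀ t, HasDerivAt (fun t => c.x t - m * t + η / 2 * (t - t₀) ^ 2)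
        (c.x' t - m + η * (t - t₀)) t := fun t =>
      (((c.hx t).sub ((hasDerivAt_id t).const_mul m)).add
        ((((hasDerivAt_id t).sub_const t₀).pow 2).const_mul (η / 2))).congr_deriv (by simp; ring)
    have b2 : ∀ t ∈ Set.Icc t₀ t₁, m * (t - t₀) - η / 2 * (t - t₀) ^ 2 ≤ c.x t := fun t ht => by
      have := le_of_hasDerivAt_nonneg d2 ht.1 fun u hu => by
        have := b1 u ⟨hu.1.le, hu.2.le.trans ht.2⟩
        linarith
      simp only [h.1] at this
      linarith
    have b3 := b2 t₁ ⟨ht₁.le, le_rfl⟩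
    have hlen : m / η < t₁ - t₀ := by
      rw [hx1] at b3
      rw [div_lt_iff₀ hη0]
      have : 0 < t₁ - t₀ := sub_pos.2 ht₁
      have : m ≤ η / 2 * (t₁ - t₀) := by
        by_contra! h6
        nlinarith
      nlinarith
    have b4 := b2 (t₀ + m / η) ⟨by linarith [div_pos hm hη0], by linarith⟩
    have b5 : m * (t₀ + m / η - t₀) - η / 2 * (t₀ + m / η - t₀) ^ 2 = 2 * C := by
      rw [hη]; field_simp; ring
    linarith [(abs_le.1 (c.bdX (t₀ + m / η))).2]

lemma not_lapStart (c : Chain p q r M C) (hp : 0 < p) (hq : 0 < q) (hr : 0 < r) (t₀ : ℝ) :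
    ¬ c.LapStart t₀ := by
  intro h
  have hC : 0 < C := h.2.1.trans_le ((le_abs_self _).trans (c.bdX' t₀))
  set m := c.x' t₀
  have hm : 0 < m := h.2.1
  set η := m ^ 2 / (4 * C)
  have hη : 0 < η := by positivity
  have key : ∀ N : ℕ, ∀ (e : Chain p q r M C) (t : ℝ), e.LapStart t → m ≤ e.x' t → η ≤ e.y t →
      e.x' t ^ 2 + N * (m / C * η ^ 2) ≤ C ^ 2 := by
    intro N
    induction N with
    | zero =>
      intro e t _ _ _
      have := sq_le_sq' (abs_le.1 (e.bdX' t)).1 (abs_le.1 (e.bdX' t)).2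
      simpa using this
    | succ N ih =>
      intro e t he h1 h2
      obtain ⟨t₁, h3, h4, h5⟩ := he.gain hp hq hr hC hm h1
      have h6 : m / C * η ^ 2 ≤ m / C * e.y t ^ 2 := by gcongr
      have h7 : m ≤ e.neg.x' t₁ := by
        refine h1.trans (abs_le_of_sq_le_sq' ?_ h3.2.1.le).2
        have : 0 < m / C * η ^ 2 := by positivity
        linarith
      have := ih e.neg t₁ h3 h7 h5
      push_cast
      linarith
  obtain ⟨t₁, h3, h4, h5⟩ := h.gain hp hq hr hC hm le_rfl
  have h6 : m ≤ c.neg.x' t₁ := by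
    refine (abs_le_of_sq_le_sq' ?_ h3.2.1.le).2
    have : 0 ≤ m / C * c.y t₀ ^ 2 := by positivity
    linarith
  have hG : 0 < m / C * η ^ 2 := by positivity
  obtain ⟨N, hN⟩ := exists_nat_gt (C ^ 2 / (m / C * η ^ 2))
  rw [div_lt_iff₀ hG] at hN
  have := key N c.neg t₁ h3 h6 h5
  nlinarith [sq_nonneg (c.neg.x' t₁)]

lemma not_start (c : Chain p q r M C) (hp : 0 < p) (hq : 0 < q) (hr : 0 < r) (t₀ : ℝ) :
    ¬ c.Start t₀ := by
  intro h
  obtain ⟨t₁, -, -, -, -, -, -, -, h1⟩ := h.lap hp hq hr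
  exact c.neg.not_lapStart hp hq hr t₁ h1

/-- Energy estimate: zero data propagate forward. -/
lemma eq_zero_of_data_fwd (c : Chain p q r M C) (hp : 0 < p) (hq : 0 < q) (hr : 0 < r)
    (hx : c.x 0 = 0) (hx' : c.x' 0 = 0) (hy : c.y 0 = 0) (hy' : c.y' 0 = 0) (hz : c.z 0 = 0)
    (hz' : c.z' 0 = 0) {t : ℝ} (ht : 0 ≤ t) : c.x t = 0 := by
  set K := 2 + p + q + r + |M|
  have hd : ∀ t, HasDerivAt (fun t => -(Real.exp (-K * t) * (c.x t ^ 2 + c.x' t ^ 2 + c.y t ^ 2 +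
      c.y' t ^ 2 + c.z t ^ 2 + c.z' t ^ 2)))
      (Real.exp (-K * t) * (K * (c.x t ^ 2 + c.x' t ^ 2 + c.y t ^ 2 + c.y' t ^ 2 + c.z t ^ 2 +
        c.z' t ^ 2) - 2 * (c.x t * c.x' t + c.x' t * (p * c.x t + c.y t) + c.y t * c.y' t +
        c.y' t * (q * c.y t + c.z t) + c.z t * c.z' t + c.z' t * (r * c.z t + -c.g t)))) t := by
    intro t
    refine ((((hasDerivAt_id t).const_mul (-K)).exp).mul (((((((c.hx t).pow 2).add
      ((c.hx' t).pow 2)).add ((c.hy t).pow 2)).add ((c.hy' t).pow 2)).add ((c.hz t).pow 2)).add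
      ((c.hz' t).pow 2))).neg.congr_deriv ?_
    simp
    ring
  have h1 := le_of_hasDerivAt_nonneg hd ht fun u _ => by
    refine mul_nonneg (Real.exp_pos _).le ?_
    have hg : 2 * (c.z' u * -c.g u) ≤ |M| * (c.x u ^ 2 + c.z' u ^ 2) := by
      have e1 : c.z' u * -c.g u ≤ |c.z' u| * |c.g u| := by
        rw [← abs_neg (c.g u), ← abs_mul]; exact le_abs_self _
      have e2 : |c.g u| ≤ |M| * |c.x u| :=
        (c.lip u).trans (mul_le_mul_of_nonneg_right (le_abs_self M) (abs_nonneg _))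
      have e3 : |c.z' u| * |c.g u| ≤ |c.z' u| * (|M| * |c.x u|) := by gcongr
      have e4 := mul_nonneg (abs_nonneg M) (sq_nonneg (|c.z' u| - |c.x u|))
      have e5 := sq_abs (c.z' u)
      have e6 := sq_abs (c.x u)
      rw [← e5, ← e6]
      nlinarith
    have f : ∀ k a b : ℝ, 0 ≤ k → 2 * (k * (a * b)) ≤ k * (a ^ 2 + b ^ 2) := fun k a b hk => by
      nlinarith [mul_nonneg hk (sq_nonneg (a - b))]
    have n := fun a : ℝ => sq_nonneg a
    have s1 := f (1 + p) (c.x u) (c.x' u) (by positivity)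
    have s2 := f 1 (c.x' u) (c.y u) (by positivity)
    have s3 := f (1 + q) (c.y u) (c.y' u) (by positivity)
    have s4 := f 1 (c.y' u) (c.z u) (by positivity)
    have s5 := f (1 + r) (c.z u) (c.z' u) (by positivity)
    have k : ∀ w a : ℝ, 0 ≤ w → 0 ≤ w * a ^ 2 := fun w a hw => mul_nonneg hw (sq_nonneg a)
    have hM := abs_nonneg M
    have t1 := k (1 + q + r) (c.x u) (by positivity)
    have t2 := k (q + r + |M|) (c.x' u) (by positivity)
    have t3 := k (p + r + |M|) (c.y u) (by positivity)
    have t4 := k (p + r + |M|) (c.y' u) (by positivity)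
    have t5 := k (p + q + |M|) (c.z u) (by positivity)
    have t6 := k (1 + p + q) (c.z' u) (by positivity)
    simp only [K]
    linarith
  simp only [hx, hx', hy, hy', hz, hz'] at h1
  have h2 : Real.exp (-K * t) * (c.x t ^ 2 + c.x' t ^ 2 + c.y t ^ 2 +
      c.y' t ^ 2 + c.z t ^ 2 + c.z' t ^ 2) ≤ 0 := by linarith
  have h3 := nonpos_of_mul_nonpos_right h2 (Real.exp_pos _)
  have : c.x t ^ 2 ≤ 0 := by
    linarith [sq_nonneg (c.x' t), sq_nonneg (c.y t), sq_nonneg (c.y' t), sq_nonneg (c.z t),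
      sq_nonneg (c.z' t)]
  exact pow_eq_zero_iff (two_ne_zero) |>.1 (le_antisymm this (sq_nonneg _))

lemma eq_zero_of_data (c : Chain p q r M C) (hp : 0 < p) (hq : 0 < q) (hr : 0 < r)
    (hx : c.x 0 = 0) (hx' : c.x' 0 = 0) (hy : c.y 0 = 0) (hy' : c.y' 0 = 0) (hz : c.z 0 = 0)
    (hz' : c.z' 0 = 0) (t : ℝ) : c.x t = 0 := by
  rcases le_total 0 t with ht | ht
  · exact c.eq_zero_of_data_fwd hp hq hr hx hx' hy hy' hz hz' ht
  · have := c.rev.eq_zero_of_data_fwd hp hq hr (by simp [rev, hx]) (by simp [rev, hx'])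
      (by simp [rev, hy]) (by simp [rev, hy']) (by simp [rev, hz]) (by simp [rev, hz'])
      (neg_nonneg.2 ht)
    simpa [rev] using this

lemma pos_right_of_data (c : Chain p q r M C) (hp : 0 < p) (hq : 0 < q)
    (hx : c.x 0 = 0) (hx' : c.x' 0 = 0)
    (h : 0 < c.y 0 ∨ (c.y 0 = 0 ∧ (0 < c.y' 0 ∨ (c.y' 0 = 0 ∧
      (0 < c.z 0 ∨ (c.z 0 = 0 ∧ 0 < c.z' 0)))))) :
    ∃ δ > 0, ∀ t ∈ Set.Ioo 0 (0 + δ), 0 < c.x t := by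
  have hyx : (∃ δ > 0, ∀ t ∈ Set.Ioo 0 (0 + δ), 0 < c.y t) →
      ∃ δ > 0, ∀ t ∈ Set.Ioo 0 (0 + δ), 0 < c.x t := fun ⟨δ, hδ, h1⟩ =>
    ⟨δ, hδ, pos_of_initial hp.le c.hx c.hx' hx.ge hx'.ge h1⟩
  have hzy : c.y 0 = 0 → c.y' 0 = 0 → (∃ δ > 0, ∀ t ∈ Set.Ioo 0 (0 + δ), 0 < c.z t) →
      ∃ δ > 0, ∀ t ∈ Set.Ioo 0 (0 + δ), 0 < c.y t := fun h1 h2 ⟨δ, hδ, h3⟩ =>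
    ⟨δ, hδ, pos_of_initial hq.le c.hy c.hy' h1.ge h2.ge h3⟩
  rcases h with h | ⟨h1, h | ⟨h2, h | ⟨h3, h⟩⟩⟩
  · exact hyx (exists_pos_right_of_pos (continuous_of_hasDerivAt c.hy) h)
  · exact hyx (exists_pos_right (c.hy 0) h1 h)
  · exact hyx (hzy h1 h2 (exists_pos_right_of_pos (continuous_of_hasDerivAt c.hz) h))
  · exact hyx (hzy h1 h2 (exists_pos_right (c.hz 0) h3 h))

lemma data_eq_zero (c : Chain p q r M C) (hp : 0 < p) (hq : 0 < q) (hr : 0 < r)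
    (hx : c.x 0 = 0) (hx' : c.x' 0 = 0) :
    c.y 0 = 0 ∧ c.y' 0 = 0 ∧ c.z 0 = 0 ∧ c.z' 0 = 0 := by
  have S : ∀ e : Chain p q r M C, e.x 0 = 0 → e.x' 0 = 0 →
      (0 < e.y 0 ∨ (e.y 0 = 0 ∧ (0 < e.y' 0 ∨ (e.y' 0 = 0 ∧
        (0 < e.z 0 ∨ (e.z 0 = 0 ∧ 0 < e.z' 0)))))) →
      ¬ ((0 ≤ e.y 0 ∧ 0 ≤ e.y' 0 ∧ 0 ≤ e.z 0) ∨ (e.z 0 ≤ 0 ∧ e.z' 0 ≤ 0 ∧ 0 ≤ e.y 0)) := by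
    intro e h1 h2 h3 h4
    refine e.not_start hp hq hr 0 ⟨h2.ge, e.pos_right_of_data hp hq h1 h2 h3, ?_⟩
    rcases h4 with h4 | h4
    · exact Or.inl h4
    · exact Or.inr ⟨h4.1, h4.2.1, Or.inl h4.2.2⟩
  have P : ∀ e : Chain p q r M C, e.x 0 = 0 → e.x' 0 = 0 → ¬ (0 < e.y 0) := by
    intro e h1 h2 h3
    have a := S e h1 h2 (Or.inl h3)
    have b := S e.rev (by simp [rev, h1]) (by simp [rev, h2]) (Or.inl (by simpa [rev] using h3))
    simp only [rev, neg_zero] at b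
    push Not at a b
    rcases le_total 0 (e.z 0) with h4 | h4
    · rcases le_total 0 (e.y' 0) with h5 | h5
      · linarith [a.1 h3.le h5]
      · linarith [b.1 h3.le (by linarith)]
    · rcases le_total (e.z' 0) 0 with h5 | h5
      · linarith [a.2 h4 h5]
      · linarith [b.2 h4 (by linarith)]
  have hy : c.y 0 = 0 := by
    have h1 := P c hx hx'
    have h2 := P c.neg (by simp [neg, hx]) (by simp [neg, hx'])
    simp only [neg] at h2
    linarith
  have P' : ∀ e : Chain p q r M C, e.x 0 = 0 → e.x' 0 = 0 → e.y 0 = 0 → ¬ (0 < e.y' 0) := by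
    intro e h1 h2 h3 h4
    have a := S e h1 h2 (Or.inr ⟨h3, Or.inl h4⟩)
    have b := S e.neg.rev (by simp [rev, neg, h1]) (by simp [rev, neg, h2])
      (Or.inr (by simpa [rev, neg, h3] using Or.inl h4))
    simp only [rev, neg, neg_zero, neg_neg] at b
    push Not at a b
    have a' := a.1 h3.ge h4.le
    have b' := b.1 (by simp [h3]) h4.le
    linarith
  have hy' : c.y' 0 = 0 := by
    have h1 := P' c hx hx' hy
    have h2 := P' c.neg (by simp [neg, hx]) (by simp [neg, hx']) (by simp [neg, hy])
    simp only [neg] at h2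
    linarith
  have P'' : ∀ e : Chain p q r M C, e.x 0 = 0 → e.x' 0 = 0 → e.y 0 = 0 → e.y' 0 = 0 →
      ¬ (0 < e.z 0) := fun e h1 h2 h3 h4 h5 =>
    S e h1 h2 (Or.inr ⟨h3, Or.inr ⟨h4, Or.inl h5⟩⟩) (Or.inl ⟨h3.ge, h4.ge, h5.le⟩)
  have hz : c.z 0 = 0 := by
    have h1 := P'' c hx hx' hy hy'
    have h2 := P'' c.neg (by simp [neg, hx]) (by simp [neg, hx']) (by simp [neg, hy])
      (by simp [neg, hy'])
    simp only [neg] at h2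
    linarith
  have P3 : ∀ e : Chain p q r M C, e.x 0 = 0 → e.x' 0 = 0 → e.y 0 = 0 → e.y' 0 = 0 → e.z 0 = 0 →
      ¬ (0 < e.z' 0) := fun e h1 h2 h3 h4 h5 h6 =>
    S e h1 h2 (Or.inr ⟨h3, Or.inr ⟨h4, Or.inr ⟨h5, h6⟩⟩⟩) (Or.inl ⟨h3.ge, h4.ge, h5.ge⟩)
  have hz' : c.z' 0 = 0 := by
    have h1 := P3 c hx hx' hy hy' hz
    have h2 := P3 c.neg (by simp [neg, hx]) (by simp [neg, hx']) (by simp [neg, hy])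
      (by simp [neg, hy']) (by simp [neg, hz])
    simp only [neg] at h2
    linarith
  exact ⟨hy, hy', hz, hz'⟩

/-- A bounded chain is determined by `x 0` and `x' 0` in the sense that it vanishes with them. -/
lemma eq_zero (c : Chain p q r M C) (hp : 0 < p) (hq : 0 < q) (hr : 0 < r)
    (hx : c.x 0 = 0) (hx' : c.x' 0 = 0) (t : ℝ) : c.x t = 0 := by
  obtain ⟨h1, h2, h3, h4⟩ := c.data_eq_zero hp hq hr hx hx'
  exact c.eq_zero_of_data hp hq hr hx hx' h1 h2 h3 h4 t

lemma even_data (c : Chain p q r M C) (hp : 0 < p) (hq : 0 < q) (hr : 0 < r)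
    (hx : 0 < c.x 0) (hx' : c.x' 0 = 0) (hy' : c.y' 0 = 0) (hz' : c.z' 0 = 0) :
    c.y 0 < 0 ∧ 0 < c.z 0 := by
  have S := fun h => c.not_start hp hq hr 0
    ⟨hx'.ge, exists_pos_right_of_pos (continuous_of_hasDerivAt c.hx) hx, h⟩
  rcases lt_or_ge (c.y 0) 0 with h1 | h1
  · refine ⟨h1, ?_⟩
    by_contra! h2
    exact S (Or.inr ⟨h2, hz'.le, Or.inr ⟨h1.le, hy'.le⟩⟩)
  · exfalso
    rcases le_total (c.z 0) 0 with h2 | h2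
    · exact S (Or.inr ⟨h2, hz'.le, Or.inl h1⟩)
    · exact S (Or.inl ⟨h1, hy'.ge, h2⟩)

lemma odd_data (c : Chain p q r M C) (hp : 0 < p) (hq : 0 < q) (hr : 0 < r)
    (hx' : 0 < c.x' 0) (hx : c.x 0 = 0) (hy : c.y 0 = 0) (hz : c.z 0 = 0) :
    c.y' 0 < 0 ∧ 0 < c.z' 0 := by
  have S := fun h => c.not_start hp hq hr 0 ⟨hx'.le, exists_pos_right (c.hx 0) hx hx', h⟩
  rcases lt_or_ge (c.y' 0) 0 with h1 | h1
  · refine ⟨h1, ?_⟩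
    by_contra! h2
    exact S (Or.inr ⟨hz.le, h2, Or.inr ⟨hy.le, h1.le⟩⟩)
  · exact absurd (Or.inl ⟨hy.ge, h1, hz.ge⟩) S

end Chain

lemma eventually_sign {ψ ψ' h : ℝ → ℝ} {l T : ℝ} (hl : 0 < l)
    (hψ : ∀ t, HasDerivAt ψ (ψ' t) t) (hψ' : ∀ t, HasDerivAt ψ' (l * ψ t + h t) t)
    (hh : ∀ t, T ≤ t → h t ≤ 0) :
    ∃ T' ≥ T, (∀ t, T' ≤ t → ψ t ≤ 0) ∨ (∀ t, T' ≤ t → 0 ≤ ψ t) := by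
  by_cases H : ∃ T' ≥ T, ∀ t, T' ≤ t → ψ t ≤ 0
  · obtain ⟨T', h1, h2⟩ := H
    exact ⟨T', h1, Or.inl h2⟩
  · push Not at H
    obtain ⟨a, ha, hpos⟩ := H T le_rfl
    refine ⟨a, ha, Or.inr fun t ht => ?_⟩
    obtain ⟨b, hb, hpos'⟩ := H t (ha.trans ht)
    exact nonneg_of_boundary hl hψ hψ' hpos.le hpos'.le (fun u hu => hh u (ha.trans hu.1.le)) t
      ⟨ht, hb⟩

lemma Chain.false_of_decay {p q r M C : ℝ} (c : Chain p q r M C) (hp : 0 < p) (hq : 0 < q)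
    (hr : 0 < r) {t₀ : ℝ} (hx : ∀ t, t₀ < t → 0 < c.x t) (hx' : ∀ t, t₀ < t → c.x' t ≤ 0)
    (hg : ∀ t, t₀ < t → p * q * r * c.x t ≤ c.g t)
    (hlim : Filter.Tendsto (fun t => q * r * c.x t - r * c.y t + c.z t) Filter.atTop (nhds 0)) :
    False := by
  have hstart : ∀ t, t₀ < t → ((0 ≤ c.y t ∧ c.y' t ≤ 0 ∧ 0 ≤ c.z t) ∨
      (c.z t ≤ 0 ∧ 0 ≤ c.z' t ∧ (0 ≤ c.y t ∨ (c.y t ≤ 0 ∧ 0 ≤ c.y' t)))) → False := by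
    intro t ht h
    refine c.rev.not_start hp hq hr (-t) ⟨?_, exists_pos_right_of_pos
      (continuous_of_hasDerivAt c.rev.hx) ?_, ?_⟩
    · simpa [Chain.rev] using hx' t ht
    · simpa [Chain.rev] using hx t ht
    · simpa [Chain.rev] using h
  have hg0 : ∀ t, t₀ < t → -c.g t ≤ 0 := fun t ht => neg_nonpos.2 (c.g_nonneg (hx t ht).le)
  obtain ⟨T, hT, hz⟩ := eventually_sign hr c.hz c.hz' (T := t₀ + 1)
    fun t ht => hg0 t (by linarith)
  have hpos : ∀ t, T ≤ t → t₀ < t := fun t ht => by linarith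
  rcases hz with hz | hz
  · obtain ⟨T₂, hT₂, hy⟩ := eventually_sign hq c.hy c.hy' hz
    have hz' := deriv_nonneg_of_concave c.hz c.hz' c.bdZ (T := T) (fun t ht => by
      have := hz t ht
      have := hg0 t (hpos t ht)
      nlinarith) T₂ hT₂
    refine hstart T₂ (hpos T₂ hT₂) (Or.inr ⟨hz T₂ hT₂, hz', ?_⟩)
    rcases hy with hy | hy
    · refine Or.inr ⟨hy T₂ le_rfl, ?_⟩
      exact deriv_nonneg_of_concave c.hy c.hy' c.bdY (T := T₂) (fun t ht => by
        have := hz t (hT₂.le.trans ht)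
        have := hy t ht
        nlinarith) T₂ le_rfl
    · exact Or.inl (hy T₂ le_rfl)
  · obtain ⟨T₂, hT₂, hy⟩ := eventually_sign hq c.neg.hy c.neg.hy' (T := T)
      fun t ht => neg_nonpos.2 (hz t ht)
    simp only [Chain.neg, neg_nonpos, neg_nonneg] at hy
    rcases hy with hy | hy
    · have hy' := deriv_nonneg_of_concave c.neg.hy c.neg.hy' c.neg.bdY (T := T₂) (fun t ht => by
        have := hz t (hT₂.le.trans ht)
        have := hy t ht
        simp only [Chain.neg]
        nlinarith) T₂ le_rfl
      simp only [Chain.neg, neg_nonneg] at hy'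
      exact hstart T₂ (hpos T₂ hT₂) (Or.inl ⟨hy T₂ le_rfl, hy', hz T₂ hT₂⟩)
    · have d1 : ∀ t, HasDerivAt (fun t => q * r * c.x t - r * c.y t + c.z t)
          (q * r * c.x' t - r * c.y' t + c.z' t) t := fun t =>
        (((c.hx t).const_mul (q * r)).sub ((c.hy t).const_mul r)).add (c.hz t)
      have d2 : ∀ t, HasDerivAt (fun t => q * r * c.x' t - r * c.y' t + c.z' t)
          (p * q * r * c.x t - c.g t) t := fun t =>
        ((((c.hx' t).const_mul (q * r)).sub ((c.hy' t).const_mul r)).add (c.hz' t)).congr_deriv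
          (by ring)
      have hb : ∀ t, |q * r * c.x t - r * c.y t + c.z t| ≤ q * r * C + r * C + C := fun t => by
        have h1 := abs_le.1 (c.bdX t)
        have h2 := abs_le.1 (c.bdY t)
        have h3 := abs_le.1 (c.bdZ t)
        have hqr := mul_pos hq hr
        rw [abs_le]
        constructor <;> nlinarith
      have d3 := deriv_nonneg_of_concave d1 d2 hb (T := T₂) fun t ht =>
        sub_nonpos.2 (hg t (hpos t (hT₂.le.trans ht)))
      have h1 : 0 < q * r * c.x T₂ - r * c.y T₂ + c.z T₂ := by
        have := mul_pos (mul_pos hq hr) (hx T₂ (hpos T₂ hT₂))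
        have := hy T₂ le_rfl
        have := hz T₂ hT₂
        nlinarith
      have h2 : q * r * c.x T₂ - r * c.y T₂ + c.z T₂ ≤ 0 :=
        ge_of_tendsto hlim (Filter.eventually_atTop.2 ⟨T₂, fun t ht =>
          le_of_hasDerivAt_nonneg d1 ht fun u hu => d3 u hu.1.le⟩)
      linarith

/-- First order Taylor estimate at the left end point. -/
lemma taylor_left {f f' f'' : ℝ → ℝ} {a b B : ℝ} (hf : ∀ t, HasDerivAt f (f' t) t)
    (hf' : ∀ t, HasDerivAt f' (f'' t) t) (hab : a < b) (hB : ∀ t ∈ Set.Icc a b, |f'' t| ≤ B) :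
    (b - a) * |f' a| ≤ |f a| + |f b| + (b - a) ^ 2 * B ∧
      |f b - f a - (b - a) * f' a| ≤ (b - a) ^ 2 * B := by
  have key : |f b - f a - (b - a) * f' a| ≤ (b - a) ^ 2 * B := by
    obtain ⟨c, hc, hc'⟩ := exists_hasDerivAt_eq_slope f f' hab
      (fun t _ => (hf t).continuousAt.continuousWithinAt) (fun t _ => hf t)
    obtain ⟨e, he, he'⟩ := exists_hasDerivAt_eq_slope f' f'' hc.1
      (fun t _ => (hf' t).continuousAt.continuousWithinAt) (fun t _ => hf' t)
    have h1 : f b - f a = (b - a) * f' c := by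
      rw [hc']; field_simp [(sub_pos.2 hab).ne']
    have h2 : f' c - f' a = (c - a) * f'' e := by
      rw [he']; field_simp [(sub_pos.2 hc.1).ne']
    have h3 : f b - f a - (b - a) * f' a = (b - a) * ((c - a) * f'' e) := by
      rw [← h2, h1]; ring
    have h4 := hB e ⟨he.1.le, (he.2.trans hc.2).le⟩
    have hba := sub_pos.2 hab
    have hca := sub_pos.2 hc.1
    rw [h3, abs_mul, abs_mul, abs_of_pos hba, abs_of_pos hca, pow_two, mul_assoc]
    have h5 : c - a ≤ b - a := by linarith [hc.2]
    gcongr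
  refine ⟨?_, key⟩
  rw [← abs_of_pos (sub_pos.2 hab), ← abs_mul, abs_of_pos (sub_pos.2 hab)]
  have h1 := abs_le.1 key
  rw [abs_le]
  constructor <;>
    linarith [le_abs_self (f a), le_abs_self (f b), neg_abs_le (f a), neg_abs_le (f b)]

lemma taylor_right {f f' f'' : ℝ → ℝ} {a b B : ℝ} (hf : ∀ t, HasDerivAt f (f' t) t)
    (hf' : ∀ t, HasDerivAt f' (f'' t) t) (hab : a < b) (hB : ∀ t ∈ Set.Icc a b, |f'' t| ≤ B) :
    (b - a) * |f' b| ≤ |f a| + |f b| + (b - a) ^ 2 * B := by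
  have h := (taylor_left (f := fun t => f (-t)) (f' := fun t => -f' (-t))
    (f'' := fun t => f'' (-t)) (B := B)
    (fun t => hasDerivAt_reflect (hf _))
    (fun t => (hasDerivAt_reflect (hf' _)).neg.congr_deriv (by ring)) (neg_lt_neg hab)
    (fun t ht => hB (-t) ⟨by linarith [ht.2], by linarith [ht.1]⟩)).1
  simp only [neg_neg, abs_neg] at h
  rw [show -a - -b = b - a by ring] at h
  linarith

open Filter in
lemma tendsto_deriv_zero {f f' f'' : ℝ → ℝ} {L B : ℝ} (hf : ∀ t, HasDerivAt f (f' t) t)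
    (hf' : ∀ t, HasDerivAt f' (f'' t) t) (hB : ∀ t, |f'' t| ≤ B)
    (hL : Tendsto f atTop (nhds L)) : Tendsto f' atTop (nhds 0) := by
  rw [Metric.tendsto_atTop]
  intro ε hε
  have hB0 : 0 ≤ B := (abs_nonneg _).trans (hB 0)
  set δ := ε / (2 * (B + 1))
  have hδ : 0 < δ := by positivity
  obtain ⟨N, hN⟩ := Metric.tendsto_atTop.1 hL (ε * δ / 4) (by positivity)
  refine ⟨N, fun t ht => ?_⟩
  have h1 := (taylor_left hf hf' (show t < t + δ by linarith) (fun u _ => hB u)).2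
  have h2 := hN t ht
  have h3 := hN (t + δ) (by linarith)
  rw [Real.dist_eq] at h2 h3 ⊢
  rw [sub_zero]
  rw [add_sub_cancel_left] at h1
  have h4 : δ * |f' t| < δ * ε := by
    have h5 : δ ^ 2 * B < δ * (ε / 2) := by
      have : δ * (B + 1) = ε / 2 := by simp only [δ]; field_simp
      nlinarith
    rw [← abs_of_pos hδ, ← abs_mul, abs_of_pos hδ]
    rw [abs_lt] at h2 h3 ⊢
    rw [abs_le] at h1
    constructor <;> nlinarith
  exact lt_of_mul_lt_mul_left h4 hδ.le

open Filter in
lemma eq_zero_of_tendsto_deriv {f f' : ℝ → ℝ} {c C : ℝ} (hf : ∀ t, HasDerivAt f (f' t) t)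
    (hC : ∀ t, |f t| ≤ C) (hc : Tendsto f' atTop (nhds c)) : c = 0 := by
  have key : ∀ (f f' : ℝ → ℝ) (c : ℝ), (∀ t, HasDerivAt f (f' t) t) → (∀ t, |f t| ≤ C) →
      Tendsto f' atTop (nhds c) → ¬ 0 < c := by
    intro f f' c hf hC hc h
    obtain ⟨T, hT⟩ := eventually_atTop.1 (hc.eventually (lt_mem_nhds (half_lt_self h)))
    exact false_of_deriv_ge hf (half_pos h) hC fun t ht => (hT t ht).le
  have h1 := key f f' c hf hC hc
  have h2 := key (fun t => -f t) (fun t => -f' t) (-c) (fun t => (hf t).neg)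
    (fun t => by simpa using hC t) hc.neg
  linarith

/-- A bounded solution of the linear sixth order equation
`φ⁽⁶⁾ - (p+q+r) φ⁽⁴⁾ + (pq+qr+rp) φ'' - pqr φ = -g`, given with its derivatives. -/
structure Six (p q r : ℝ) (φ : ℕ → ℝ → ℝ) (g : ℝ → ℝ) : Prop where
  deriv : ∀ k < 5, ∀ t, HasDerivAt (φ k) (φ (k + 1) t) t
  top : ∀ t, HasDerivAt (φ 5)
    ((p + q + r) * φ 4 t - (p * q + q * r + r * p) * φ 2 t + p * q * r * φ 0 t - g t) t
  sign : ∀ t, 0 ≤ g t * φ 0 t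
  lip : ∃ M, ∀ t, |g t| ≤ M * |φ 0 t|
  bdd : ∃ C, ∀ k ≤ 5, ∀ t, |φ k t| ≤ C

namespace Six

variable {p q r : ℝ} {φ : ℕ → ℝ → ℝ} {g : ℝ → ℝ}

lemma perm (h : Six p q r φ g) {p' q' r' : ℝ} (e1 : p' + q' + r' = p + q + r)
    (e2 : p' * q' + q' * r' + r' * p' = p * q + q * r + r * p) (e3 : p' * q' * r' = p * q * r) :
    Six p' q' r' φ g :=
  ⟨h.deriv, by rw [e1, e2, e3]; exact h.top, h.sign, h.lip, h.bdd⟩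

lemma exists_chain (h : Six p q r φ g) (hp : 0 < p) (hq : 0 < q) :
    ∃ M C, ∃ c : Chain p q r M C, (∀ t, c.x t = φ 0 t) ∧ (∀ t, c.x' t = φ 1 t) ∧
      (∀ t, c.y t = φ 2 t - p * φ 0 t) ∧ (∀ t, c.y' t = φ 3 t - p * φ 1 t) ∧
      (∀ t, c.z t = φ 4 t - (p + q) * φ 2 t + p * q * φ 0 t) ∧
      (∀ t, c.z' t = φ 5 t - (p + q) * φ 3 t + p * q * φ 1 t) ∧ ∀ t, c.g t = g t := by
  obtain ⟨M, hM⟩ := h.lip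
  obtain ⟨C, hC⟩ := h.bdd
  have hC0 : 0 ≤ C := (abs_nonneg _).trans (hC 0 (by norm_num) 0)
  have hpq := mul_pos hp hq
  have e1 := mul_nonneg hp.le hC0
  have e2 := mul_nonneg hq.le hC0
  have e3 := mul_nonneg hpq.le hC0
  have b : ∀ k ≤ 5, ∀ t, |φ k t| ≤ C + p * C + q * C + p * q * C := fun k hk t =>
    (hC k hk t).trans (by linarith)
  have b2 : ∀ k ≤ 3, ∀ t, |φ (k + 2) t - p * φ k t| ≤ C + p * C + q * C + p * q * C := by
    intro k hk t
    have h1 := abs_le.1 (hC k (by omega) t)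
    have h2 := abs_le.1 (hC (k + 2) (by omega) t)
    rw [abs_le]
    constructor <;> nlinarith
  have b3 : ∀ k ≤ 1, ∀ t, |φ (k + 4) t - (p + q) * φ (k + 2) t + p * q * φ k t| ≤
      C + p * C + q * C + p * q * C := by
    intro k hk t
    have h1 := abs_le.1 (hC k (by omega) t)
    have h2 := abs_le.1 (hC (k + 2) (by omega) t)
    have h3 := abs_le.1 (hC (k + 4) (by omega) t)
    rw [abs_le]
    constructor <;> nlinarith
  have d := fun k (hk : k < 5) t => h.deriv k hk t
  refine ⟨M, C + p * C + q * C + p * q * C,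
    { x := φ 0, x' := φ 1, y := fun t => φ 2 t - p * φ 0 t, y' := fun t => φ 3 t - p * φ 1 t,
      z := fun t => φ 4 t - (p + q) * φ 2 t + p * q * φ 0 t,
      z' := fun t => φ 5 t - (p + q) * φ 3 t + p * q * φ 1 t, g := g,
      hx := d 0 (by norm_num),
      hx' := fun t => (d 1 (by norm_num) t).congr_deriv (by ring),
      hy := fun t => (d 2 (by norm_num) t).sub ((d 0 (by norm_num) t).const_mul p),
      hy' := fun t => ((d 3 (by norm_num) t).sub ((d 1 (by norm_num) t).const_mul p)).congr_deriv
        (by ring),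
      hz := fun t => ((d 4 (by norm_num) t).sub ((d 2 (by norm_num) t).const_mul (p + q))).add
        ((d 0 (by norm_num) t).const_mul (p * q)),
      hz' := fun t => (((h.top t).sub ((d 3 (by norm_num) t).const_mul (p + q))).add
        ((d 1 (by norm_num) t).const_mul (p * q))).congr_deriv (by ring),
      sign := h.sign, lip := hM,
      bdX := b 0 (by norm_num), bdX' := b 1 (by norm_num),
      bdY := b2 0 (by norm_num), bdY' := b2 1 (by norm_num),
      bdZ := b3 0 (by norm_num), bdZ' := b3 1 (by norm_num) },
    fun _ => rfl, fun _ => rfl, fun _ => rfl, fun _ => rfl, fun _ => rfl, fun _ => rfl,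
    fun _ => rfl⟩

lemma eq_zero (h : Six p q r φ g) (hp : 0 < p) (hq : 0 < q) (hr : 0 < r)
    (h0 : φ 0 0 = 0) (h1 : φ 1 0 = 0) : ∀ k ≤ 5, ∀ t, φ k t = 0 := by
  obtain ⟨M, C, c, c0, c1, -⟩ := h.exists_chain hp hq
  have hz : ∀ t, φ 0 t = 0 := fun t => by
    rw [← c0]; exact c.eq_zero hp hq hr (by rw [c0, h0]) (by rw [c1, h1]) t
  intro k
  induction k with
  | zero => exact fun _ => hz
  | succ k ih =>
    intro hk t
    have e : φ k = fun _ => 0 := funext (ih (by omega))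
    have := h.deriv k (by omega) t
    rw [e] at this
    exact this.unique (hasDerivAt_const t 0)

lemma even_data (h : Six p q r φ g) (hp : 0 < p) (hq : 0 < q) (hr : 0 < r)
    (h0 : 0 < φ 0 0) (h1 : φ 1 0 = 0) (h3 : φ 3 0 = 0) (h5 : φ 5 0 = 0) :
    φ 2 0 < p * φ 0 0 ∧ 0 < φ 4 0 - (p + q) * φ 2 0 + p * q * φ 0 0 := by
  obtain ⟨M, C, c, c0, c1, c2, c3, c4, c5, -⟩ := h.exists_chain hp hq
  have := c.even_data hp hq hr (by rwa [c0]) (by rwa [c1]) (by rw [c3, h1, h3]; ring)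
    (by rw [c5, h1, h3, h5]; ring)
  rw [c2, c4] at this
  exact ⟨by linarith [this.1], this.2⟩

lemma odd_data (h : Six p q r φ g) (hp : 0 < p) (hq : 0 < q) (hr : 0 < r)
    (h1 : 0 < φ 1 0) (h0 : φ 0 0 = 0) (h2 : φ 2 0 = 0) (h4 : φ 4 0 = 0) :
    φ 3 0 < p * φ 1 0 ∧ 0 < φ 5 0 - (p + q) * φ 3 0 + p * q * φ 1 0 := by
  obtain ⟨M, C, c, c0, c1, c2, c3, c4, c5, -⟩ := h.exists_chain hp hq
  have := c.odd_data hp hq hr (by rwa [c1]) (by rwa [c0]) (by rw [c2, h0, h2]; ring)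
    (by rw [c4, h0, h2, h4]; ring)
  rw [c3, c5] at this
  exact ⟨by linarith [this.1], this.2⟩

end Six

/-- Roots of the characteristic polynomial, and a superlinear odd nonlinearity `f` with derivative
`f'` and primitive `F`. -/
structure Setting (p q r : ℝ) (f f' F : ℝ → ℝ) : Prop where
  p_pos : 0 < p
  p_lt_q : p < q
  q_lt_r : q < r
  odd : ∀ x, f (-x) = -f x
  hasDerivAt_f : ∀ x, HasDerivAt f (f' x) x
  continuous_f' : Continuous f'
  f'_nonneg : ∀ x, 0 ≤ f' x
  hasDerivAt_F : ∀ x, HasDerivAt F (f x) x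
  even : ∀ x, F (-x) = F x
  superlinear : ∀ x y, 0 < x → x ≤ y → f x * y ≤ f y * x

/-- A bounded solution, given with its derivatives. -/
structure BddSol (p q r : ℝ) (f : ℝ → ℝ) (d : ℕ → ℝ → ℝ) : Prop where
  deriv : ∀ k < 6, ∀ t, HasDerivAt (d k) (d (k + 1) t) t
  ode : ∀ t, d 6 t = (p + q + r) * d 4 t - (p * q + q * r + r * p) * d 2 t + p * q * r * d 0 t
    - f (d 0 t)
  bdd : ∃ C, ∀ k ≤ 5, ∀ t, |d k t| ≤ C

/-- The Hamiltonian energy in terms of the derivatives. -/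
def energy (p q r : ℝ) (F : ℝ → ℝ) (d : ℕ → ℝ → ℝ) (t : ℝ) : ℝ :=
  d 5 t * d 1 t - d 4 t * d 2 t + 1 / 2 * d 3 t ^ 2
    - (p + q + r) * (d 3 t * d 1 t - 1 / 2 * d 2 t ^ 2)
    + (p * q + q * r + r * p) / 2 * d 1 t ^ 2 - p * q * r / 2 * d 0 t ^ 2 + F (d 0 t)

variable {p q r : ℝ} {f f' F : ℝ → ℝ} {d e : ℕ → ℝ → ℝ}

namespace Setting

lemma q_pos (S : Setting p q r f f' F) : 0 < q := S.p_pos.trans S.p_lt_q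

lemma r_pos (S : Setting p q r f f' F) : 0 < r := S.q_pos.trans S.q_lt_r

lemma mono (S : Setting p q r f f' F) : Monotone f := fun _ _ h =>
  le_of_hasDerivAt_nonneg S.hasDerivAt_f h fun t _ => S.f'_nonneg t

end Setting

namespace BddSol

lemma continuous (h : BddSol p q r f d) {k : ℕ} (hk : k < 6) : Continuous (d k) :=
  continuous_of_hasDerivAt (h.deriv k hk)

lemma shift (h : BddSol p q r f d) (s : ℝ) : BddSol p q r f fun k t => d k (t + s) where
  deriv k hk t := (h.deriv k hk (t + s)).comp_add_const t s
  ode t := h.ode (t + s)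
  bdd := h.bdd.imp fun _ hC k hk t => hC k hk (t + s)

lemma neg (S : Setting p q r f f' F) (h : BddSol p q r f d) :
    BddSol p q r f fun k t => -d k t where
  deriv k hk t := (h.deriv k hk t).neg
  ode t := by rw [h.ode, S.odd]; ring
  bdd := h.bdd.imp fun _ hC k hk t => by simpa using hC k hk t

lemma reflect (h : BddSol p q r f d) : BddSol p q r f fun k t => (-1) ^ k * d k (-t) where
  deriv k hk t := ((hasDerivAt_reflect (h.deriv k hk (-t))).const_mul ((-1) ^ k)).congr_deriv
    (by ring)
  ode t := by
    have := h.ode (-t)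
    norm_num
    linarith
  bdd := h.bdd.imp fun _ hC k hk t => by simpa [abs_mul] using hC k hk (-t)

lemma const {h : ℝ} (hh : p * q * r * h = f h) :
    BddSol p q r f fun k _ => if k = 0 then h else 0 where
  deriv k _ t := by simpa using hasDerivAt_const t (if k = 0 then h else 0)
  ode t := by simp [hh]
  bdd := ⟨|h|, fun k _ t => by by_cases hk : k = 0 <;> simp [hk]⟩

/-- The difference of two bounded solutions solves a linear equation with a restoring force. -/
lemma diff (S : Setting p q r f f' F) (hd : BddSol p q r f d) (he : BddSol p q r f e) :
    Six p q r (fun k t => d k t - e k t) fun t => f (d 0 t) - f (e 0 t) where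
  deriv k hk t := (hd.deriv k (by omega) t).sub (he.deriv k (by omega) t)
  top t := ((hd.deriv 5 (by norm_num) t).sub (he.deriv 5 (by norm_num) t)).congr_deriv (by
    rw [hd.ode, he.ode]; ring)
  sign t := by
    rcases le_total (d 0 t) (e 0 t) with h | h
    · exact mul_nonneg_of_nonpos_of_nonpos (sub_nonpos.2 (S.mono h)) (sub_nonpos.2 h)
    · exact mul_nonneg (sub_nonneg.2 (S.mono h)) (sub_nonneg.2 h)
  lip := by
    obtain ⟨C, hC⟩ := hd.bdd
    obtain ⟨D, hD⟩ := he.bdd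
    obtain ⟨M, hM⟩ := (isCompact_Icc (a := -max C D) (b := max C D)).exists_bound_of_continuousOn
      S.continuous_f'.continuousOn
    refine ⟨M, fun t => ?_⟩
    have h1 := abs_le.1 ((hC 0 (by norm_num) t).trans (le_max_left C D))
    have h2 := abs_le.1 ((hD 0 (by norm_num) t).trans (le_max_right C D))
    exact (convex_Icc (-max C D) (max C D)).norm_image_sub_le_of_norm_hasDerivWithin_le
      (fun x _ => (S.hasDerivAt_f x).hasDerivWithinAt) hM h2 h1
  bdd := by
    obtain ⟨C, hC⟩ := hd.bdd
    obtain ⟨D, hD⟩ := he.bdd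
    exact ⟨C + D, fun k hk t => (abs_sub _ _).trans (add_le_add (hC k hk t) (hD k hk t))⟩

lemma bdd_six (S : Setting p q r f f' F) (hd : BddSol p q r f d) :
    ∃ C, ∀ k ≤ 6, ∀ t, |d k t| ≤ C := by
  obtain ⟨C, hC⟩ := hd.bdd
  have hC0 : 0 ≤ C := (abs_nonneg _).trans (hC 0 (by norm_num) 0)
  have hp := S.p_pos
  have hq := S.q_pos
  have hr := S.r_pos
  have hfC : ∀ t, |f (d 0 t)| ≤ f C := fun t => by
    have := abs_le.1 (hC 0 (by norm_num) t)
    rw [abs_le, ← S.odd]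
    exact ⟨S.mono this.1, S.mono this.2⟩
  have hf0 : 0 ≤ f C := (abs_nonneg _).trans (hfC 0)
  have k1 : 0 ≤ (p + q + r) * C := by positivity
  have k2 : 0 ≤ (p * q + q * r + r * p) * C := by positivity
  have k3 : 0 ≤ p * q * r * C := by positivity
  refine ⟨C + (p + q + r) * C + (p * q + q * r + r * p) * C + p * q * r * C + f C,
    fun k hk t => ?_⟩
  rcases hk.eq_or_lt with rfl | hk
  · have a4 : |(p + q + r) * d 4 t| ≤ (p + q + r) * C := by
      rw [abs_mul, abs_of_pos (by positivity)]
      gcongr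
      exact hC 4 (by norm_num) t
    have a2 : |(p * q + q * r + r * p) * d 2 t| ≤ (p * q + q * r + r * p) * C := by
      rw [abs_mul, abs_of_pos (by positivity)]
      gcongr
      exact hC 2 (by norm_num) t
    have a0 : |p * q * r * d 0 t| ≤ p * q * r * C := by
      rw [abs_mul, abs_of_pos (by positivity)]
      gcongr
      exact hC 0 (by norm_num) t
    have af := abs_le.1 (hfC t)
    rw [abs_le] at a4 a2 a0 ⊢
    rw [hd.ode]
    constructor <;> linarith
  · exact (hC k (by omega) t).trans (by linarith)

/-- The derivative of a bounded solution solves the linearized equation. -/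
lemma linearized (S : Setting p q r f f' F) (hd : BddSol p q r f d) :
    Six p q r (fun k t => d (k + 1) t) fun t => f' (d 0 t) * d 1 t where
  deriv k hk t := hd.deriv (k + 1) (by omega) t
  top t := by
    have e : d (5 + 1) = fun t => (p + q + r) * d 4 t - (p * q + q * r + r * p) * d 2 t
        + p * q * r * d 0 t - f (d 0 t) := funext hd.ode
    rw [e]
    exact ((((hd.deriv 4 (by norm_num) t).const_mul _).sub
      ((hd.deriv 2 (by norm_num) t).const_mul _)).add
      ((hd.deriv 0 (by norm_num) t).const_mul _)).sub
      ((S.hasDerivAt_f (d 0 t)).comp t (hd.deriv 0 (by norm_num) t))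
  sign t := by
    have := mul_nonneg (S.f'_nonneg (d 0 t)) (mul_self_nonneg (d 1 t))
    linarith
  lip := by
    obtain ⟨C, hC⟩ := hd.bdd
    obtain ⟨M, hM⟩ := (isCompact_Icc (a := -C) (b := C)).exists_bound_of_continuousOn
      S.continuous_f'.continuousOn
    refine ⟨M, fun t => ?_⟩
    rw [abs_mul]
    gcongr
    exact hM _ (abs_le.1 (hC 0 (by norm_num) t))
  bdd := by
    obtain ⟨C, hC⟩ := hd.bdd_six S
    exact ⟨C, fun k hk t => hC (k + 1) (by omega) t⟩

/-- Bounded solutions are determined by their value and slope at one point. -/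
lemma unique (S : Setting p q r f f' F) (hd : BddSol p q r f d) (he : BddSol p q r f e)
    {a b : ℝ} (h0 : d 0 a = e 0 b) (h1 : d 1 a = e 1 b) :
    ∀ k ≤ 5, ∀ t, d k (t + a) = e k (t + b) := by
  intro k hk t
  have := ((hd.shift a).diff S (he.shift b)).eq_zero S.p_pos S.q_pos S.r_pos
    (by simp [h0]) (by simp [h1]) k hk t
  exact sub_eq_zero.1 this

lemma odd_derivs_eq_zero (S : Setting p q r f f' F) (hd : BddSol p q r f d) {s : ℝ}
    (h1 : d 1 s = 0) : d 3 s = 0 ∧ d 5 s = 0 := by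
  have key := (hd.shift s).unique S (hd.shift s).reflect (a := 0) (b := 0) (by simp) (by simp [h1])
  have h3 := key 3 (by norm_num) 0
  have h5 := key 5 (by norm_num) 0
  norm_num at h3 h5
  exact ⟨by linarith, by linarith⟩

lemma even_derivs_eq_zero (S : Setting p q r f f' F) (hd : BddSol p q r f d)
    (h0 : d 0 0 = 0) : d 2 0 = 0 ∧ d 4 0 = 0 := by
  have key := hd.unique S (hd.reflect.neg S) (a := 0) (b := 0) (by simp [h0]) (by simp)
  have h2 := key 2 (by norm_num) 0
  have h4 := key 4 (by norm_num) 0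
  norm_num at h2 h4
  exact ⟨by linarith, by linarith⟩

lemma derivs_eq_zero (S : Setting p q r f f' F) (hd : BddSol p q r f d) {s : ℝ}
    (h1 : d 1 s = 0) (h2 : d 2 s = 0) : ∀ k ≤ 5, ∀ t, d (k + 1) t = 0 := by
  intro k hk t
  have := ((hd.shift s).linearized S).eq_zero S.p_pos S.q_pos S.r_pos
    (by simpa using h1) (by simpa using h2) k hk (t - s)
  simpa using this

lemma hasDerivAt_energy (S : Setting p q r f f' F) (hd : BddSol p q r f d) (t : ℝ) :
    HasDerivAt (energy p q r F d) 0 t := by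
  have D := fun k hk => hd.deriv k hk t
  have d0 := D 0 (by norm_num)
  have d1 := D 1 (by norm_num)
  have d2 := D 2 (by norm_num)
  have d3 := D 3 (by norm_num)
  have d4 := D 4 (by norm_num)
  have d5 := D 5 (by norm_num)
  refine (((((((d5.mul d1).sub (d4.mul d2)).add ((d3.pow 2).const_mul (1 / 2))).sub
    (((d3.mul d1).sub ((d2.pow 2).const_mul (1 / 2))).const_mul (p + q + r))).add
    ((d1.pow 2).const_mul ((p * q + q * r + r * p) / 2))).sub
    ((d0.pow 2).const_mul (p * q * r / 2))).add
    ((S.hasDerivAt_F (d 0 t)).comp t d0)).congr_deriv ?_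
  simp only [Nat.reduceAdd, hd.ode]
  simp
  ring

lemma energy_eq (S : Setting p q r f f' F) (hd : BddSol p q r f d) (s t : ℝ) :
    energy p q r F d s = energy p q r F d t :=
  is_const_of_deriv_eq_zero (fun u => (hd.hasDerivAt_energy S u).differentiableAt)
    (fun u => (hd.hasDerivAt_energy S u).deriv) s t

open Filter in
/-- A bounded solution cannot be positive and increasing on a whole half-line. -/
lemma not_increasing (S : Setting p q r f f' F) (hd : BddSol p q r f d) {t₀ : ℝ}
    (hpos : ∀ t, t₀ < t → 0 < d 0 t) (hinc : ∀ t, t₀ < t → 0 < d 1 t) : False := by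
  obtain ⟨C, hC⟩ := hd.bdd_six S
  have D := fun k hk => hd.deriv k hk
  have hp := S.p_pos
  have hq := S.q_pos
  have hr := S.r_pos
  have hlt : ∀ s t, t₀ < s → s < t → d 0 s < d 0 t := fun s t hs hst =>
    lt_of_hasDerivAt_pos (D 0 (by norm_num)) hst fun u hu => hinc u (hs.trans hu.1)
  have hmono : Monotone fun t => d 0 (max t (t₀ + 1)) := by
    intro s t hst
    rcases (max_le_max_right (t₀ + 1) hst).eq_or_lt with h | h
    · simp only [h, le_refl]
    · exact (hlt _ _ (by linarith [le_max_right s (t₀ + 1)]) h).le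
  have hbd : BddAbove (Set.range fun t => d 0 (max t (t₀ + 1))) :=
    ⟨C, by rintro _ ⟨t, rfl⟩; exact (abs_le.1 (hC 0 (by norm_num) _)).2⟩
  have hlim := tendsto_atTop_ciSup hmono hbd
  set h := ⨆ t, d 0 (max t (t₀ + 1))
  have hle : ∀ t, t₀ < t → d 0 t < h := by
    intro t ht
    have h1 := le_ciSup hbd (t + 1)
    rw [max_eq_left (by linarith)] at h1
    exact (hlt t (t + 1) ht (by linarith)).trans_le h1
  have l0 : Tendsto (d 0) atTop (nhds h) := hlim.congr' (by
    filter_upwards [eventually_ge_atTop (t₀ + 1)] with t ht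
    rw [max_eq_left ht])
  have l1 := tendsto_deriv_zero (D 0 (by norm_num)) (D 1 (by norm_num)) (hC 2 (by norm_num)) l0
  have l2 := tendsto_deriv_zero (D 1 (by norm_num)) (D 2 (by norm_num)) (hC 3 (by norm_num)) l1
  have l3 := tendsto_deriv_zero (D 2 (by norm_num)) (D 3 (by norm_num)) (hC 4 (by norm_num)) l2
  have l4 := tendsto_deriv_zero (D 3 (by norm_num)) (D 4 (by norm_num)) (hC 5 (by norm_num)) l3
  have l6 : Tendsto (d 6) atTop (nhds (p * q * r * h - f h)) := by
    have e : d 6 = fun t => (p + q + r) * d 4 t - (p * q + q * r + r * p) * d 2 t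
        + p * q * r * d 0 t - f (d 0 t) := funext hd.ode
    rw [e]
    have := ((((l4.const_mul (p + q + r)).sub (l2.const_mul (p * q + q * r + r * p))).add
      (l0.const_mul (p * q * r))).sub ((S.hasDerivAt_f h).continuousAt.tendsto.comp l0))
    simpa using this
  have hh : p * q * r * h = f h :=
    sub_eq_zero.1 (eq_zero_of_tendsto_deriv (D 5 (by norm_num)) (hC 5 (by norm_num)) l6)
  obtain ⟨M, C', c, c0, c1, c2, c3, c4, c5, c6⟩ := ((const hh).diff S hd).exists_chain hp hq
  refine c.false_of_decay hp hq hr (t₀ := t₀) (fun t ht => ?_) (fun t ht => ?_) (fun t ht => ?_) ?_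
  · simpa [c0] using hle t ht
  · simpa [c1] using (hinc t ht).le
  · have h1 := S.superlinear _ _ (hpos t ht) (hle t ht).le
    have hh0 : 0 < h := (hpos t ht).trans (hle t ht)
    have h2 : f (d 0 t) ≤ p * q * r * d 0 t := by
      rw [← hh] at h1
      refine le_of_mul_le_mul_right ?_ hh0
      linarith
    simp only [c0, c6, if_true]
    linarith
  · have L := ((((tendsto_const_nhds (x := h)).sub l0).const_mul (q * r)).sub
      ((l2.neg.sub (((tendsto_const_nhds (x := h)).sub l0).const_mul p)).const_mul r)).add
      ((l4.neg.sub (l2.neg.const_mul (p + q))).add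
        (((tendsto_const_nhds (x := h)).sub l0).const_mul (p * q)))
    simp only [sub_self, neg_zero, mul_zero, add_zero] at L
    refine L.congr fun t => ?_
    simp [c0, c2, c4]

end BddSol

lemma energy_neg (S : Setting p q r f f' F) (t : ℝ) :
    energy p q r F (fun k t => -d k t) t = energy p q r F d t := by
  simp only [energy, S.even]
  ring

lemma energy_reflect (t : ℝ) :
    energy p q r F (fun k t => (-1) ^ k * d k (-t)) t = energy p q r F d (-t) := by
  simp only [energy]
  norm_num

namespace BddSol

lemma energy_lt_of_zero (S : Setting p q r f f' F) (hd : BddSol p q r f d)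
    (he : BddSol p q r f e) (hd0 : d 0 0 = 0) (he0 : e 0 0 = 0) (h1 : e 1 0 < d 1 0)
    (h2 : 0 ≤ e 1 0) : energy p q r F e 0 < energy p q r F d 0 := by
  obtain ⟨hd2, hd4⟩ := hd.even_derivs_eq_zero S hd0
  obtain ⟨he2, he4⟩ := he.even_derivs_eq_zero S he0
  have hp := S.p_pos
  have hq := S.q_pos
  have hr := S.r_pos
  have U := hd.diff S he
  have V := hd.diff S (he.neg S)
  have u3 := ((U.perm (p' := q) (q' := r) (r' := p) (by ring) (by ring) (by ring)).odd_data hq hr hp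
    (by linarith) (by simp [hd0, he0]) (by simp [hd2, he2]) (by simp [hd4, he4])).1
  have v3 := ((V.perm (p' := q) (q' := r) (r' := p) (by ring) (by ring) (by ring)).odd_data hq hr hp
    (by linarith) (by simp [hd0, he0]) (by simp [hd2, he2]) (by simp [hd4, he4])).1
  have u5 := ((U.perm (p' := p) (q' := r) (r' := q) (by ring) (by ring) (by ring)).odd_data hp hr hq
    (by linarith) (by simp [hd0, he0]) (by simp [hd2, he2]) (by simp [hd4, he4])).2
  have v5 := ((V.perm (p' := p) (q' := r) (r' := q) (by ring) (by ring) (by ring)).odd_data hp hr hq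
    (by linarith) (by simp [hd0, he0]) (by simp [hd2, he2]) (by simp [hd4, he4])).2
  simp only [sub_neg_eq_add] at u3 v3 u5 v5
  have hu : 0 < d 1 0 - e 1 0 := by linarith
  have hv : 0 < d 1 0 + e 1 0 := by linarith
  have k1 := mul_pos u5 hv
  have k2 := mul_pos v5 hu
  have k3 := mul_pos (sub_pos.2 u3) (sub_pos.2 v3)
  have k4 := mul_pos (mul_pos (sub_pos.2 S.p_lt_q) (sub_pos.2 S.q_lt_r)) (mul_pos hu hv)
  simp only [energy, hd0, he0, hd2, he2, hd4, he4]
  linarith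

/-- A bounded solution that starts positive and nondecreasing has a first maximum. -/
lemma exists_first_max (S : Setting p q r f f' F) (hd : BddSol p q r f d) (h0 : 0 < d 0 0)
    (h1 : 0 ≤ d 1 0) : ∃ s ≥ 0, d 1 s = 0 ∧ d 2 s ≤ 0 ∧ ∀ t ∈ Set.Ioo 0 s, 0 < d 1 t := by
  by_cases hs : d 1 0 = 0 ∧ d 2 0 ≤ 0
  · exact ⟨0, le_rfl, hs.1, hs.2, fun t ht => absurd ht.1 ht.2.not_gt⟩
  have hpos : ∃ δ > 0, ∀ t ∈ Set.Ioo 0 (0 + δ), 0 < d 1 t := by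
    rcases h1.eq_or_lt with h | h
    · exact exists_pos_right (hd.deriv 1 (by norm_num) 0) h.symm
        (by by_contra! h'; exact hs ⟨h.symm, h'⟩)
    · exact exists_pos_right_of_pos (hd.continuous (by norm_num)) h
  obtain ⟨δ, hδ, hpos⟩ := hpos
  rw [zero_add] at hpos
  have key : ∃ T, δ / 2 ≤ T ∧ d 1 T ≤ 0 := by
    by_contra! hT
    have hinc : ∀ t, 0 < t → 0 < d 1 t := fun t ht => by
      rcases lt_or_ge t (δ / 2) with h | h
      · exact hpos t ⟨ht, by linarith⟩
      · exact hT t h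
    exact hd.not_increasing S (t₀ := 0) (fun t ht => h0.trans
      (lt_of_hasDerivAt_pos (hd.deriv 0 (by norm_num)) ht fun u hu => hinc u hu.1)) hinc
  obtain ⟨T, hT1, hT2⟩ := key
  obtain ⟨s, k1, -, k3, k4⟩ := exists_first_zero (hd.continuous (by norm_num))
    (hpos (δ / 2) ⟨by linarith, by linarith⟩) hT1 hT2
  have hinc : ∀ t ∈ Set.Ioo 0 s, 0 < d 1 t := fun t ht => by
    rcases lt_or_ge t (δ / 2) with h | h
    · exact hpos t ⟨ht.1, by linarith⟩
    · exact k4 t ⟨h, ht.2⟩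
  refine ⟨s, by linarith, k3, ?_, hinc⟩
  by_contra! h3
  obtain ⟨ε, hε, h4⟩ := exists_pos_right (f := fun t => -d 1 (-t)) (a := -s)
    (hasDerivAt_reflect (hd.deriv 1 (by norm_num) _)).neg (by simp [k3]) (by simpa using h3)
  obtain ⟨u, hu1, hu2⟩ := exists_between (lt_min (show -s < -s + ε by linarith)
    (show -s < 0 by linarith))
  have h5 := h4 u ⟨hu1, hu2.trans_le (min_le_left _ _)⟩
  have h6 := hinc (-u) ⟨by linarith [min_le_right (-s + ε) 0], by linarith⟩
  linarith

/-- Inequalities between the derivatives at a maximum. -/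
lemma max_data (S : Setting p q r f f' F) (hd : BddSol p q r f d) {s : ℝ} (h1 : d 1 s = 0)
    (h2 : d 2 s ≤ 0) :
    p * d 2 s ≤ d 4 s ∧ r * (d 4 s - (p + q) * d 2 s + p * q * d 0 s) ≤ f (d 0 s) := by
  rcases h2.eq_or_lt with h2 | h2
  · have h := hd.derivs_eq_zero S h1 h2
    have h4 := h 3 (by norm_num) s
    have h6 := h 5 (by norm_num) s
    have ho := hd.ode s
    norm_num at h4 h6
    rw [h6, h4, h2] at ho
    rw [h4, h2]
    constructor <;> linarith
  · obtain ⟨h3, h5⟩ := hd.odd_derivs_eq_zero S h1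
    have := (((hd.shift s).neg S).linearized S).odd_data S.p_pos S.q_pos S.r_pos
      (by simpa using h2) (by simp [h1]) (by simp [h3]) (by simp [h5])
    simp only [zero_add, Nat.reduceAdd, hd.ode] at this
    constructor <;> linarith

/-- The larger initial slope leads to the larger first maximum. -/
lemma max_lt_max (S : Setting p q r f f' F) (hd : BddSol p q r f d) (he : BddSol p q r f e)
    (h0 : d 0 0 = e 0 0) (h1 : e 1 0 < d 1 0) {s t : ℝ} (hs : 0 < s) (ht : 0 ≤ t)
    (hds : d 1 s = 0) (hdpos : ∀ u ∈ Set.Ioo 0 s, 0 < d 1 u)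
    (het : e 1 t = 0) (hepos : ∀ u ∈ Set.Ioo 0 t, 0 < e 1 u) : e 0 t < d 0 s := by
  have dinc : ∀ u v, 0 ≤ u → u < v → v ≤ s → d 0 u < d 0 v := fun u v hu huv hv =>
    lt_of_hasDerivAt_pos (hd.deriv 0 (by norm_num)) huv fun w hw =>
      hdpos w ⟨hu.trans_lt hw.1, hw.2.trans_le hv⟩
  have einc : ∀ u v, 0 ≤ u → u < v → v ≤ t → e 0 u < e 0 v := fun u v hu huv hv =>
    lt_of_hasDerivAt_pos (he.deriv 0 (by norm_num)) huv fun w hw =>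
      hepos w ⟨hu.trans_lt hw.1, hw.2.trans_le hv⟩
  have cd0 := hd.continuous (k := 0) (by norm_num)
  have cd1 := hd.continuous (k := 1) (by norm_num)
  have ce0 := he.continuous (k := 0) (by norm_num)
  have ce1 := he.continuous (k := 1) (by norm_num)
  by_contra! hle
  have hlift : ∀ u ∈ Set.Icc 0 s, ∃ v ∈ Set.Icc 0 t, e 0 v = d 0 u := by
    intro u hu
    refine intermediate_value_Icc ht ce0.continuousOn ⟨?_, ?_⟩
    · rcases hu.1.eq_or_lt with h | h
      · rw [← h, h0]
      · rw [← h0]; exact (dinc 0 u le_rfl h hu.2).le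
    · refine le_trans ?_ hle
      rcases hu.2.eq_or_lt with h | h
      · rw [h]
      · exact (dinc u s hu.1 h le_rfl).le
  have hK : IsCompact (Set.Icc 0 s ×ˢ Set.Icc 0 t) := isCompact_Icc.prod isCompact_Icc
  have hA : IsClosed (Prod.fst '' ((Set.Icc 0 s ×ˢ Set.Icc 0 t) ∩
      {z : ℝ × ℝ | e 0 z.2 = d 0 z.1 ∧ e 1 z.2 ≤ d 1 z.1})) :=
    ((hK.inter_right ((isClosed_eq (ce0.comp continuous_snd) (cd0.comp continuous_fst)).inter
      (isClosed_le (ce1.comp continuous_snd) (cd1.comp continuous_fst)))).image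
      continuous_fst).isClosed
  have hB : IsClosed (Prod.fst '' ((Set.Icc 0 s ×ˢ Set.Icc 0 t) ∩
      {z : ℝ × ℝ | e 0 z.2 = d 0 z.1 ∧ d 1 z.1 ≤ e 1 z.2})) :=
    ((hK.inter_right ((isClosed_eq (ce0.comp continuous_snd) (cd0.comp continuous_fst)).inter
      (isClosed_le (cd1.comp continuous_fst) (ce1.comp continuous_snd)))).image
      continuous_fst).isClosed
  obtain ⟨u, -, ⟨⟨_, v⟩, ⟨hz, a1, a2⟩, rfl⟩, ⟨⟨u, v'⟩, ⟨hz', b1, b2⟩, rfl⟩⟩ :=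
    isPreconnected_closed_iff.1 (isPreconnected_Icc (a := (0 : ℝ)) (b := s)) _ _ hA hB
      (fun u hu => by
        obtain ⟨v, hv, huv⟩ := hlift u hu
        rcases le_total (e 1 v) (d 1 u) with h | h
        · exact Or.inl ⟨(u, v), ⟨⟨hu, hv⟩, huv, h⟩, rfl⟩
        · exact Or.inr ⟨(u, v), ⟨⟨hu, hv⟩, huv, h⟩, rfl⟩)
      ⟨0, ⟨le_rfl, hs.le⟩, (0, 0), ⟨⟨⟨le_rfl, hs.le⟩, ⟨le_rfl, ht⟩⟩, h0.symm, h1.le⟩, rfl⟩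
      (by
        obtain ⟨v, hv, huv⟩ := hlift s ⟨hs.le, le_rfl⟩
        refine ⟨s, ⟨hs.le, le_rfl⟩, (s, v), ⟨⟨⟨hs.le, le_rfl⟩, hv⟩, huv, ?_⟩, rfl⟩
        simp only [hds]
        rcases hv.1.eq_or_lt with h | h
        · rw [← h] at huv
          linarith [dinc 0 s le_rfl hs le_rfl]
        · rcases hv.2.eq_or_lt with h' | h'
          · rw [h', het]
          · exact (hepos v ⟨h, h'⟩).le)
  simp only at a1 a2 b1 b2 hz hz'
  have hvv : v = v' := by
    rcases lt_trichotomy v v' with h | h | h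
    · linarith [einc v v' hz.2.1 h hz'.2.2]
    · exact h
    · linarith [einc v' v hz'.2.1 h hz.2.2]
  subst hvv
  have huniq := hd.unique S he (a := u) (b := v) a1.symm (le_antisymm b2 a2)
  rcases lt_trichotomy u v with h | h | h
  · have h2 := huniq 0 (by norm_num) (-u)
    rw [neg_add_cancel, h0] at h2
    linarith [einc 0 (-u + v) le_rfl (by linarith) (by linarith [hz.1.1, hz.2.2])]
  · subst h
    have h2 := huniq 1 (by norm_num) (-u)
    rw [neg_add_cancel] at h2
    linarith
  · have h2 := huniq 0 (by norm_num) (-v)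
    rw [neg_add_cancel, ← h0] at h2
    linarith [dinc 0 (-v + u) le_rfl (by linarith) (by linarith [hz.2.1, hz.1.2])]

end BddSol

lemma max_energy_inequality {p q r x X y Y β R : ℝ} (hp : 0 < p) (hpq : p < q) (hqr : q < r)
    (hx : 0 ≤ x) (hX : 0 < X) (hβ : 0 < β) (hy : -(p * x) ≤ y) (hY : -(p * X) ≤ Y)
    (hR : r * (y + (p + q) * x) ≤ R) (h1 : x - X < p * β)
    (h2 : 0 < Y - y - (p + q) * (x - X) + p * q * β) :
    0 < X * Y - x * y + 1 / 2 * (p + q + r) * (X ^ 2 - x ^ 2) + R * β := by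
  have hq : 0 < q := hp.trans hpq
  have hr : 0 < r := hq.trans hqr
  have hRx : q * r * x ≤ R := by nlinarith
  rcases le_or_gt x X with h | h
  · obtain ⟨e, rfl⟩ : ∃ e, X = x + e := ⟨X - x, by ring⟩
    have he : 0 ≤ e := by linarith
    have k1 := mul_nonneg hx h2.le
    have k2 := mul_le_mul_of_nonneg_left hY he
    have k3 := mul_le_mul_of_nonneg_right hRx hβ.le
    have k4 : 0 < x * e * (r - p) + e ^ 2 * ((q + r - p) / 2) + x * β * (q * (r - p)) := by
      have hrp : 0 < r - p := by linarith
      have hqrp : 0 < (q + r - p) / 2 := by linarith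
      rcases hx.eq_or_lt with h3 | h3
      · subst h3
        have : 0 < e := by linarith
        positivity
      · positivity
    linarith
  · obtain ⟨g, rfl⟩ : ∃ g, x = X + g := ⟨x - X, by ring⟩
    have hg : 0 < g := by linarith
    have hgβ : g < p * β := by linarith
    have hgr : 0 < r * β - g := by nlinarith
    have k1 := mul_pos hX h2
    have k2 := mul_le_mul_of_nonneg_left hR hg.le
    have k3 := mul_le_mul_of_nonneg_right hRx hgr.le
    have k4 : 0 < (p * β - g) * (q * (r * (X + g) - p * X)) := by
      have : 0 < r * (X + g) - p * X := by nlinarith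
      have : 0 < p * β - g := by linarith
      positivity
    have k5 : 0 < (X + g) * ((q - p) * (r - p)) := by
      have : 0 < q - p := by linarith
      have : 0 < r - p := by linarith
      positivity
    have k6 : 0 < p * g * (q + r - p) := by
      have : 0 < q + r - p := by linarith
      positivity
    have k7 := mul_pos hg k5
    have k8 := mul_pos hg k6
    have key : 0 < p * r * (X * Y - (X + g) * y + 1 / 2 * (p + q + r) * (X ^ 2 - (X + g) ^ 2)
        + R * β) := by
      have hpr := mul_pos hp hr
      have k1' := mul_pos hpr k1
      have k2' := mul_le_mul_of_nonneg_left k2 hp.le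
      have k3' := mul_le_mul_of_nonneg_left k3 hp.le
      have k4' := mul_pos hr k4
      have k7' := mul_pos hr k7
      have k8' := mul_pos hr k8
      linarith
    exact (mul_pos_iff_of_pos_left (mul_pos hp hr)).1 key

namespace BddSol

lemma energy_lt_of_pos (S : Setting p q r f f' F) (hd : BddSol p q r f d)
    (he : BddSol p q r f e) (h0 : d 0 0 = e 0 0) (hpos : 0 < e 0 0) (h1 : e 1 0 < d 1 0)
    (h2 : 0 ≤ e 1 0) : energy p q r F e 0 < energy p q r F d 0 := by
  obtain ⟨t, ht, e1, e2, epos⟩ := he.exists_first_max S hpos h2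
  obtain ⟨s, hs, d1, d2, dpos⟩ := hd.exists_first_max S (by rwa [h0]) (by linarith)
  have hs0 : 0 < s := by
    refine lt_of_le_of_ne hs ?_
    rintro rfl
    linarith
  have hlt := hd.max_lt_max S he h0 h1 hs0 ht d1 dpos e1 epos
  have hb : 0 < e 0 t := hpos.trans_le
    (le_of_hasDerivAt_nonneg (he.deriv 0 (by norm_num)) ht fun u hu => (epos u hu).le)
  obtain ⟨e3, e5⟩ := he.odd_derivs_eq_zero S e1
  obtain ⟨d3, d5⟩ := hd.odd_derivs_eq_zero S d1
  have d2' : d 2 s < 0 := lt_of_le_of_ne d2 fun h => by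
    have := hd.derivs_eq_zero S d1 h 0 (by norm_num) 0
    norm_num at this
    linarith
  obtain ⟨m1, m2⟩ := he.max_data S e1 e2
  obtain ⟨m3, -⟩ := hd.max_data S d1 d2
  have E := ((hd.shift s).diff S (he.shift t)).even_data S.p_pos S.q_pos S.r_pos
    (by simpa using hlt) (by simp [d1, e1]) (by simp [d3, e3]) (by simp [d5, e5])
  simp only [zero_add] at E
  have I := max_energy_inequality (x := -e 2 t) (X := -d 2 s) (y := e 4 t) (Y := d 4 s)
    (β := d 0 s - e 0 t) (R := f (e 0 t) - p * q * r * e 0 t) S.p_pos S.p_lt_q S.q_lt_r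
    (by linarith) (by linarith) (by linarith) (by linarith) (by linarith) (by linarith)
    (by linarith [E.1]) (by linarith [E.2])
  have hR : 0 ≤ f (e 0 t) - p * q * r * e 0 t := by
    have := S.p_pos
    have := S.q_pos
    have := S.r_pos
    have := mul_le_mul_of_nonneg_left m1 S.r_pos.le
    have : 0 ≤ q * r * (-e 2 t) := mul_nonneg (by positivity) (by linarith)
    linarith
  have hF : f (e 0 t) / e 0 t / 2 * (d 0 s ^ 2 - e 0 t ^ 2) ≤ F (d 0 s) - F (e 0 t) := by
    have D : ∀ u, HasDerivAt (fun u => F u - f (e 0 t) / e 0 t / 2 * u ^ 2)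
        (f u - f (e 0 t) / e 0 t * u) u := fun u =>
      ((S.hasDerivAt_F u).sub (((hasDerivAt_id u).pow 2).const_mul _)).congr_deriv
        (by simp; ring)
    have := le_of_hasDerivAt_nonneg D hlt.le fun u hu => by
      rw [sub_nonneg, div_mul_eq_mul_div, div_le_iff₀ hb]
      exact S.superlinear _ _ hb hu.1.le
    linarith
  have hF' : (f (e 0 t) - p * q * r * e 0 t) * (d 0 s - e 0 t)
      + p * q * r / 2 * (d 0 s ^ 2 - e 0 t ^ 2) ≤
      f (e 0 t) / e 0 t / 2 * (d 0 s ^ 2 - e 0 t ^ 2) := by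
    have h4 : 0 ≤ (f (e 0 t) - p * q * r * e 0 t) * (d 0 s - e 0 t) ^ 2 / (2 * e 0 t) :=
      div_nonneg (mul_nonneg hR (sq_nonneg _)) (by linarith)
    have h5 : f (e 0 t) / e 0 t / 2 * (d 0 s ^ 2 - e 0 t ^ 2)
        = (f (e 0 t) - p * q * r * e 0 t) * (d 0 s - e 0 t)
          + p * q * r / 2 * (d 0 s ^ 2 - e 0 t ^ 2)
          + (f (e 0 t) - p * q * r * e 0 t) * (d 0 s - e 0 t) ^ 2 / (2 * e 0 t) := by
      field_simp
      ring
    linarith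
  rw [he.energy_eq S 0 t, hd.energy_eq S 0 s]
  simp only [energy, d1, d3, d5, e1, e3, e5]
  linarith

/-- Two bounded solutions with equal value and ordered slopes at `0` have ordered energies. -/
lemma energy_lt (S : Setting p q r f f' F) (hd : BddSol p q r f d)
    (he : BddSol p q r f e) (h0 : d 0 0 = e 0 0) (h1 : e 1 0 < d 1 0)
    (h2 : 0 ≤ e 1 0) : energy p q r F e 0 < energy p q r F d 0 := by
  rcases lt_trichotomy (e 0 0) 0 with h | h | h
  · have := energy_lt_of_pos S (hd.reflect.neg S) (he.reflect.neg S) (by simp [h0])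
      (by simpa using h) (by simpa using h1) (by simpa using h2)
    simpa [energy_neg S, energy_reflect] using this
  · exact energy_lt_of_zero S hd he (h0.trans h) h h1 h2
  · exact energy_lt_of_pos S hd he h0 h h1 h2

end BddSol

section Interpolation

variable {d : ℕ → ℝ → ℝ} {M : ℝ}

/-- A Landau inequality on a bounded window, at the right or left end point. -/
lemma landau {f f' f'' : ℝ → ℝ} {A B T ε s : ℝ} (hf : ∀ t, HasDerivAt f (f' t) t)
    (hf' : ∀ t, HasDerivAt f' (f'' t) t) (hε : 0 < ε) (hε1 : ε ≤ 1) (hT : 1 ≤ T)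
    (hA : ∀ t ∈ Set.Icc (-T) T, |f t| ≤ A) (hB : ∀ t ∈ Set.Icc (-T) T, |f'' t| ≤ B)
    (hs : s ∈ Set.Icc (-T) T) : ε * |f' s| ≤ 2 * A + ε ^ 2 * B := by
  obtain ⟨hs1, hs2⟩ := hs
  rcases le_total s 0 with h | h
  · have h1 := (taylor_left hf hf' (show s < s + ε by linarith) fun t ht =>
      hB t ⟨by linarith [ht.1], by linarith [ht.2]⟩).1
    rw [add_sub_cancel_left] at h1
    linarith [hA s ⟨hs1, hs2⟩, hA (s + ε) ⟨by linarith, by linarith⟩]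
  · have h1 := taylor_right hf hf' (show s - ε < s by linarith) fun t ht =>
      hB t ⟨by linarith [ht.1], by linarith [ht.2]⟩
    rw [sub_sub_cancel] at h1
    linarith [hA s ⟨hs1, hs2⟩, hA (s - ε) ⟨by linarith, by linarith⟩]

/-- Interpolation of a derivative by the next one, uniformly over bounded windows. -/
lemma interpolate_succ (hd : ∀ k < 6, ∀ t, HasDerivAt (d k) (d (k + 1) t) t)
    (hM : ∀ t, |d 0 t| ≤ M) : ∀ k ≤ 5, ∀ δ > 0, ∃ C, ∀ T ≥ 1, ∀ B ≥ 0,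
      (∀ t ∈ Set.Icc (-T) T, |d (k + 1) t| ≤ B) →
      ∀ t ∈ Set.Icc (-T) T, |d k t| ≤ δ * B + C := by
  intro k
  induction k with
  | zero =>
    intro _ δ hδ
    exact ⟨M, fun T _ B hB _ t _ => (hM t).trans (by nlinarith)⟩
  | succ k ih =>
    intro hk δ hδ
    set ε := min 1 (δ / 2)
    have hε : 0 < ε := lt_min one_pos (half_pos hδ)
    obtain ⟨C, hC⟩ := ih (by omega) (ε / 4) (by positivity)
    refine ⟨4 * C / ε, fun T hT B hB h t ht => ?_⟩
    obtain ⟨s, hs, hmax⟩ := isCompact_Icc.exists_isMaxOn ⟨t, ht⟩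
      (continuous_of_hasDerivAt (hd (k + 1) (by omega))).abs.continuousOn
    refine (hmax ht).trans ?_
    change |d (k + 1) s| ≤ _
    have h1 := landau (hd k (by omega)) (hd (k + 1) (by omega)) hε (min_le_left _ _) hT
      (hC T hT _ (abs_nonneg _) fun u hu => hmax hu) h hs
    have h2 : ε * |d (k + 1) s| ≤ ε * (2 * ε * B + 4 * C / ε) := by
      have : ε * (2 * ε * B + 4 * C / ε) = 2 * ε ^ 2 * B + 4 * C := by field_simp
      linarith
    have h3 : 2 * ε ≤ δ := by linarith [min_le_right 1 (δ / 2)]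
    have h4 := le_of_mul_le_mul_left h2 hε
    have h5 := mul_le_mul_of_nonneg_right h3 hB
    linarith

/-- Interpolation of the lower derivatives by the sixth, uniformly over bounded windows. -/
lemma interpolate (hd : ∀ k < 6, ∀ t, HasDerivAt (d k) (d (k + 1) t) t)
    (hM : ∀ t, |d 0 t| ≤ M) : ∀ j ≤ 5, ∀ δ > 0, ∃ C, ∀ T ≥ 1, ∀ B ≥ 0,
      (∀ t ∈ Set.Icc (-T) T, |d 6 t| ≤ B) →
      ∀ t ∈ Set.Icc (-T) T, |d (5 - j) t| ≤ δ * B + C := by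
  intro j
  induction j with
  | zero => exact fun _ => interpolate_succ hd hM 5 le_rfl
  | succ j ih =>
    intro hj δ hδ
    obtain ⟨C, hC⟩ := ih (by omega) δ hδ
    obtain ⟨C', hC'⟩ := interpolate_succ hd hM (5 - (j + 1)) (by omega) 1 one_pos
    refine ⟨C + C', fun T hT B hB h t ht => ?_⟩
    have h1 := hC T hT B hB h
    have h2 := hC' T hT (δ * B + C) ((abs_nonneg _).trans (h1 t ht)) (by
      rwa [show 5 - (j + 1) + 1 = 5 - j by omega]) t ht
    linarith

/-- The derivatives of a bounded solution are bounded. -/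
lemma exists_bound (hd : ∀ k < 6, ∀ t, HasDerivAt (d k) (d (k + 1) t) t)
    (hM : ∀ t, |d 0 t| ≤ M) (hc : Continuous (d 6)) {a b c L : ℝ} {f : ℝ → ℝ}
    (hf : ∀ t, |f (d 0 t)| ≤ L)
    (ode : ∀ t, d 6 t = a * d 4 t - b * d 2 t + c * d 0 t - f (d 0 t)) :
    ∃ C, ∀ k ≤ 5, ∀ t, |d k t| ≤ C := by
  set δ := 1 / (2 * (|a| + |b| + 1))
  have hδ : 0 < δ := by positivity
  obtain ⟨C4, h4⟩ := interpolate hd hM 1 (by norm_num) δ hδ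
  obtain ⟨C2, h2⟩ := interpolate hd hM 3 (by norm_num) δ hδ
  have key : ∀ T ≥ 1, ∀ t ∈ Set.Icc (-T) T,
      |d 6 t| ≤ 2 * (|a| * C4 + |b| * C2 + |c| * M + L) := by
    intro T hT t ht
    obtain ⟨s, hs, hmax⟩ := isCompact_Icc.exists_isMaxOn ⟨t, ht⟩ hc.abs.continuousOn
    refine (hmax ht).trans ?_
    change |d 6 s| ≤ _
    have e4 := h4 T hT _ (abs_nonneg _) (fun u hu => hmax hu) s hs
    have e2 := h2 T hT _ (abs_nonneg _) (fun u hu => hmax hu) s hs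
    norm_num at e4 e2
    have e6 : |d 6 s| ≤ |a| * |d 4 s| + |b| * |d 2 s| + |c| * |d 0 s| + |f (d 0 s)| := by
      rw [← abs_mul, ← abs_mul, ← abs_mul]
      conv_lhs => rw [ode s]
      calc _ ≤ |a * d 4 s - b * d 2 s + c * d 0 s| + |f (d 0 s)| := abs_sub _ _
        _ ≤ |a * d 4 s - b * d 2 s| + |c * d 0 s| + |f (d 0 s)| := by
          gcongr; exact abs_add_le _ _
        _ ≤ _ := by gcongr; exact abs_sub _ _
    have e0 := mul_le_mul_of_nonneg_left (hM s) (abs_nonneg c)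
    have e4' := mul_le_mul_of_nonneg_left e4 (abs_nonneg a)
    have e2' := mul_le_mul_of_nonneg_left e2 (abs_nonneg b)
    have e5 : (|a| + |b|) * δ ≤ 1 / 2 := by
      have : (|a| + |b| + 1) * δ = 1 / 2 := by simp only [δ]; field_simp
      nlinarith
    have e7 := mul_le_mul_of_nonneg_right e5 (abs_nonneg (d 6 s))
    nlinarith [hf s]
  set B := 2 * (|a| * C4 + |b| * C2 + |c| * M + L)
  have hB : 0 ≤ B := (abs_nonneg _).trans (key 1 le_rfl 0 (by simp))
  have hex : ∀ j ≤ 5, ∃ C, ∀ t, |d (5 - j) t| ≤ C := fun j hj => by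
    obtain ⟨C, h⟩ := interpolate hd hM j hj 1 one_pos
    refine ⟨1 * B + C, fun t => h (|t| + 1) (by linarith [abs_nonneg t]) B hB
      (key _ (by linarith [abs_nonneg t])) t ⟨?_, ?_⟩⟩
    · linarith [neg_abs_le t]
    · linarith [le_abs_self t]
  choose! C hC using hex
  refine ⟨∑ j ∈ Finset.range 6, C j, fun k hk t => ?_⟩
  have h1 := hC (5 - k) (by omega) t
  rw [show 5 - (5 - k) = k by omega] at h1
  exact h1.trans (Finset.single_le_sum (f := C) (fun j hj => (abs_nonneg _).trans
    (hC j (by simp at hj; omega) 0)) (by simp; omega))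

end Interpolation

section Power

variable {a : ℝ}

lemma hasDerivAt_abs_rpow_mul (ha : 0 < a) (x : ℝ) :
    HasDerivAt (fun x => |x| ^ a * x) ((a + 1) * |x| ^ a) x := by
  rcases eq_or_ne x 0 with rfl | hx
  · rw [abs_zero, zero_rpow ha.ne', mul_zero, hasDerivAt_iff_tendsto_slope]
    have h : Continuous fun x : ℝ => |x| ^ a := continuous_abs.rpow_const fun _ => Or.inr ha.le
    have h1 := h.tendsto 0
    rw [abs_zero, zero_rpow ha.ne'] at h1
    refine (h1.mono_left nhdsWithin_le_nhds).congr' ?_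
    filter_upwards [self_mem_nhdsWithin] with t ht
    simp [slope_def_field, mul_div_assoc, div_self (show t ≠ 0 from ht)]
  · have h := ((hasDerivAt_abs hx).rpow_const (p := a) (Or.inl (abs_ne_zero.2 hx))).mul
      (hasDerivAt_id x)
    refine h.congr_deriv ?_
    have h1 : (SignType.sign x : ℝ) * x = |x| := by simp
    have h2 : |x| ^ (a - 1) * |x| = |x| ^ a := by
      rw [← rpow_add_one (abs_ne_zero.2 hx), sub_add_cancel]
    simp only [id]
    linear_combination a * |x| ^ (a - 1) * h1 + a * h2

end Power

/-- The nonlinearity of (O6). -/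
def nonlin (n : ℕ) (x : ℝ) : ℝ := cN n * (|x| ^ (12 / ((n : ℝ) - 6)) * x)

lemma cN_nonneg {n : ℕ} (hn : 7 ≤ n) : 0 ≤ cN n := by
  have h : (7 : ℝ) ≤ n := by exact_mod_cast hn
  have h1 : 0 ≤ (n : ℝ) ^ 4 - 20 * (n : ℝ) ^ 2 + 64 := by
    have : (n : ℝ) ^ 4 - 20 * (n : ℝ) ^ 2 + 64 = ((n : ℝ) ^ 2 - 4) * ((n : ℝ) ^ 2 - 16) := by ring
    rw [this]
    apply mul_nonneg <;> nlinarith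
  have h2 : 0 ≤ (n : ℝ) - 6 := by linarith
  unfold cN
  positivity

lemma setting {n : ℕ} (hn : 7 ≤ n) : Setting (((n : ℝ) - 6) ^ 2 / 4) (((n : ℝ) - 2) ^ 2 / 4)
    (((n : ℝ) + 2) ^ 2 / 4) (nonlin n)
    (fun x => cN n * ((12 / ((n : ℝ) - 6) + 1) * |x| ^ (12 / ((n : ℝ) - 6))))
    (fun x => cHat n * |x| ^ (2 * (n : ℝ) / ((n : ℝ) - 6))) := by
  have h : (7 : ℝ) ≤ n := by exact_mod_cast hn
  have h6 : 0 < (n : ℝ) - 6 := by linarith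
  have ha : 0 < 12 / ((n : ℝ) - 6) := by positivity
  have hc := cN_nonneg hn
  exact {
    p_pos := by positivity
    p_lt_q := by nlinarith
    q_lt_r := by nlinarith
    odd := fun x => by simp [nonlin]
    hasDerivAt_f := fun x => (hasDerivAt_abs_rpow_mul ha x).const_mul (cN n)
    continuous_f' := by
      have : Continuous fun x : ℝ => |x| ^ (12 / ((n : ℝ) - 6)) :=
        continuous_abs.rpow_const fun _ => Or.inr ha.le
      fun_prop
    f'_nonneg := fun x => by positivity
    hasDerivAt_F := fun x => by
      have e : 2 * (n : ℝ) / ((n : ℝ) - 6) = 12 / ((n : ℝ) - 6) + 2 := by field_simp; ring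
      have e2 : cN n = cHat n * (2 * (n : ℝ) / ((n : ℝ) - 6)) := by
        unfold cN cHat
        field_simp
        ring
      refine ((hasDerivAt_abs_rpow x (p := 2 * (n : ℝ) / ((n : ℝ) - 6))
        (by rw [e]; linarith)).const_mul (cHat n)).congr_deriv ?_
      rw [show 2 * (n : ℝ) / ((n : ℝ) - 6) - 2 = 12 / ((n : ℝ) - 6) by rw [e]; ring, nonlin, e2]
      ring
    even := fun x => by simp
    superlinear := fun x y hx hxy => by
      have hy : 0 < y := hx.trans_le hxy
      have h1 : x ^ (12 / ((n : ℝ) - 6)) ≤ y ^ (12 / ((n : ℝ) - 6)) :=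
        rpow_le_rpow hx.le hxy ha.le
      have h2 := mul_le_mul_of_nonneg_left h1 (mul_nonneg hc (mul_pos hx hy).le)
      rw [nonlin, nonlin, abs_of_pos hx, abs_of_pos hy]
      linarith }

lemma K4_eq (n : ℕ) :
    K4 n = ((n : ℝ) - 6) ^ 2 / 4 + ((n : ℝ) - 2) ^ 2 / 4 + ((n : ℝ) + 2) ^ 2 / 4 := by
  unfold K4; ring

lemma K2_eq (n : ℕ) :
    K2 n = ((n : ℝ) - 6) ^ 2 / 4 * (((n : ℝ) - 2) ^ 2 / 4)
      + ((n : ℝ) - 2) ^ 2 / 4 * (((n : ℝ) + 2) ^ 2 / 4)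
      + ((n : ℝ) + 2) ^ 2 / 4 * (((n : ℝ) - 6) ^ 2 / 4) := by
  unfold K2; ring

lemma K0_eq (n : ℕ) :
    K0 n = ((n : ℝ) - 6) ^ 2 / 4 * (((n : ℝ) - 2) ^ 2 / 4) * (((n : ℝ) + 2) ^ 2 / 4) := by
  unfold K0; ring

lemma Ham_eq_energy (n : ℕ) (v : ℝ → ℝ) (t : ℝ) :
    Ham n v t = energy (((n : ℝ) - 6) ^ 2 / 4) (((n : ℝ) - 2) ^ 2 / 4) (((n : ℝ) + 2) ^ 2 / 4)
      (fun x => cHat n * |x| ^ (2 * (n : ℝ) / ((n : ℝ) - 6))) (fun k => iteratedDeriv k v) t := by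
  rw [Ham, energy, ← K4_eq, ← K2_eq, ← K0_eq, iteratedDeriv_zero]

lemma bddSol {n : ℕ} (hn : 7 ≤ n) {v : ℝ → ℝ} (hv : IsSolO6 n v)
    (hb : ∃ M : ℝ, ∀ t : ℝ, |v t| ≤ M) :
    BddSol (((n : ℝ) - 6) ^ 2 / 4) (((n : ℝ) - 2) ^ 2 / 4) (((n : ℝ) + 2) ^ 2 / 4) (nonlin n)
      (fun k => iteratedDeriv k v) := by
  obtain ⟨M, hM⟩ := hb
  have S := setting hn
  have hd : ∀ k < 6, ∀ t, HasDerivAt (iteratedDeriv k v) (iteratedDeriv (k + 1) v t) t := by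
    intro k hk t
    rw [iteratedDeriv_succ]
    exact (hv.1.differentiable_iteratedDeriv k (by exact_mod_cast hk) t).hasDerivAt
  have ode : ∀ t, iteratedDeriv 6 v t = K4 n * iteratedDeriv 4 v t - K2 n * iteratedDeriv 2 v t
      + K0 n * iteratedDeriv 0 v t - nonlin n (iteratedDeriv 0 v t) := fun t => by
    have := hv.2 t
    rw [iteratedDeriv_zero, nonlin]
    linarith
  refine ⟨hd, fun t => ?_, exists_bound (L := nonlin n M) hd (by simpa using hM)
    (hv.1.continuous_iteratedDeriv 6 le_rfl) (fun t => ?_) ode⟩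
  · rw [← K4_eq, ← K2_eq, ← K0_eq]
    exact ode t
  · rw [iteratedDeriv_zero, abs_le, ← S.odd]
    exact ⟨S.mono (abs_le.1 (hM t)).1, S.mono (abs_le.1 (hM t)).2⟩

end SixthOrder

theorem energy_ordering_of_bounded_solutions
    (n : ℕ) (hn : 7 ≤ n) (v₁ v₂ : ℝ → ℝ)
    (hv₁ : IsSolO6 n v₁) (hv₂ : IsSolO6 n v₂)
    (hb₁ : ∃ M : ℝ, ∀ t : ℝ, |v₁ t| ≤ M) (hb₂ : ∃ M : ℝ, ∀ t : ℝ, |v₂ t| ≤ M)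
    (h0 : v₁ 0 = v₂ 0)
    (h1 : (deriv v₂ 0 < deriv v₁ 0 ∧ 0 ≤ deriv v₂ 0) ∨
          (deriv v₁ 0 < deriv v₂ 0 ∧ deriv v₂ 0 ≤ 0)) :
    Ham n v₂ 0 < Ham n v₁ 0 := by
  have S := SixthOrder.setting hn
  have B₁ := SixthOrder.bddSol hn hv₁ hb₁
  have B₂ := SixthOrder.bddSol hn hv₂ hb₂
  rw [SixthOrder.Ham_eq_energy, SixthOrder.Ham_eq_energy]
  rcases h1 with h1 | h1
  · exact B₁.energy_lt S B₂ (by simpa using h0) (by simpa using h1.1) (by simpa using h1.2)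
  · have h := B₁.reflect.energy_lt S B₂.reflect (by simpa using h0) (by simpa using h1.1)
      (by simpa using h1.2)
    rwa [SixthOrder.energy_reflect, SixthOrder.energy_reflect, neg_zero] at h
end
end

section
/- Let v₁ and v₂ be bounded, positive solutions of the ODE (O6) such that v₁(t) → 0 and v₂(t) → 0 as t → +∞ and as t → -∞, and such that v₁'(0) = v₂'(0) = 0. Then v₁(t) = v₂(t) for all t ∈ ℝ. That is, the positive homoclinic solution of (O6) is unique up to translation. -/
noncomputable section

open Real

open Filter

/-- `y` is not eventually bounded below by a positive multiple of `exp (l * t)`. -/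
def Subexp (l : ℝ) (y : ℝ → ℝ) : Prop :=
  ∀ c > 0, ∀ T : ℝ, ∃ t ≥ T, y t < c * exp (l * t)

/-- Both `y` and `-y` are `Subexp`. -/
def AbsSubexp (l : ℝ) (y : ℝ → ℝ) : Prop :=
  Subexp l y ∧ Subexp l (fun t => - y t)

lemma monotone_of_hasDerivAt_nonneg_Ici {f f' : ℝ → ℝ} {T : ℝ}
    (hf : ∀ t, HasDerivAt f (f' t) t) (h : ∀ t ≥ T, 0 ≤ f' t) {s t : ℝ} (hs : T ≤ s)
    (hst : s ≤ t) : f s ≤ f t := by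
  have hm : MonotoneOn f (Set.Ici T) := by
    refine monotoneOn_of_deriv_nonneg (convex_Ici T)
      (fun t _ => (hf t).continuousAt.continuousWithinAt)
      (fun t _ => (hf t).differentiableAt.differentiableWithinAt) ?_
    intro t ht
    rw [interior_Ici] at ht
    rw [(hf t).deriv]
    exact h t (le_of_lt ht)
  exact hm (Set.mem_Ici.2 hs) (Set.mem_Ici.2 (hs.trans hst)) hst

lemma exists_forall_lt_mul_exp {c κ : ℝ} (hc : 0 < c) (hκ : 0 < κ) (C : ℝ) :
    ∃ T : ℝ, ∀ t ≥ T, C < c * exp (κ * t) := by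
  have h : Tendsto (fun t : ℝ => c * exp (κ * t)) atTop atTop :=
    (tendsto_exp_atTop.comp (tendsto_id.const_mul_atTop hκ)).const_mul_atTop hc
  exact eventually_atTop.1 (h.eventually_gt_atTop C)

lemma hasDerivAt_exp_const_mul (a t : ℝ) :
    HasDerivAt (fun s => exp (a * s)) (a * exp (a * t)) t := by
  simpa [mul_comm] using ((hasDerivAt_id t).const_mul a).exp

lemma Subexp.mono {l : ℝ} {y z : ℝ → ℝ} (hy : Subexp l y) (h : ∀ t, z t ≤ y t) :
    Subexp l z := fun c hc T =>
  let ⟨t, ht, hlt⟩ := hy c hc T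
  ⟨t, ht, (h t).trans_lt hlt⟩

lemma subexp_of_le_exp {l σ C : ℝ} {y : ℝ → ℝ} (hσ : σ < l)
    (h : ∀ t ≥ 0, y t ≤ C * exp (σ * t)) : Subexp l y := by
  intro c hc T
  obtain ⟨T', hT'⟩ := exists_forall_lt_mul_exp hc (sub_pos.2 hσ) C
  let t := max T (max T' 0)
  have h0 : 0 ≤ t := (le_max_right _ _).trans (le_max_right _ _)
  refine ⟨t, le_max_left _ _, (h t h0).trans_lt ?_⟩
  have h1 := hT' t ((le_max_left _ _).trans (le_max_right _ _))
  calc C * exp (σ * t) < c * exp ((l - σ) * t) * exp (σ * t) :=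
        mul_lt_mul_of_pos_right h1 (exp_pos _)
    _ = c * exp (l * t) := by rw [mul_assoc, ← exp_add]; ring_nf

lemma absSubexp_of_abs_le_exp {l σ C : ℝ} {y : ℝ → ℝ} (hσ : σ < l)
    (h : ∀ t ≥ 0, |y t| ≤ C * exp (σ * t)) : AbsSubexp l y :=
  ⟨subexp_of_le_exp hσ fun t ht => (le_abs_self _).trans (h t ht),
    subexp_of_le_exp hσ fun t ht => (neg_le_abs _).trans (h t ht)⟩

lemma Subexp.deriv_add {l μ : ℝ} {y y' : ℝ → ℝ} (hμ : -l < μ)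
    (hy : ∀ t, HasDerivAt y (y' t) t) (h : Subexp l y) :
    Subexp l (fun t => μ * y t + y' t) := by
  intro c hc T
  by_contra! hcon
  have hlm : 0 < l + μ := by linarith
  let φ : ℝ → ℝ := fun t => exp (μ * t) * y t - c / (l + μ) * exp ((l + μ) * t)
  have hφ : ∀ t, HasDerivAt φ (exp (μ * t) * (μ * y t + y' t - c * exp (l * t))) t := by
    intro t
    have h1 := ((hasDerivAt_exp_const_mul μ t).mul (hy t)).sub
      ((hasDerivAt_exp_const_mul (l + μ) t).const_mul (c / (l + μ)))
    refine h1.congr_deriv ?_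
    have h2 : exp ((l + μ) * t) = exp (μ * t) * exp (l * t) := by
      rw [← exp_add]; ring_nf
    rw [h2]
    field_simp
  obtain ⟨T', hT'⟩ := exists_forall_lt_mul_exp (c := c / (l + μ) / 2) (by positivity) hlm (-φ T)
  obtain ⟨t, ht, hlt⟩ := h (c / (l + μ) / 2) (by positivity) (max T T')
  have h3 : φ T ≤ φ t := monotone_of_hasDerivAt_nonneg_Ici hφ
    (fun s hs => mul_nonneg (exp_pos _).le (sub_nonneg.2 (hcon s hs))) le_rfl
    ((le_max_left _ _).trans ht)
  have h4 := hT' t ((le_max_right _ _).trans ht)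
  have h5 : exp (μ * t) * y t < c / (l + μ) / 2 * exp ((l + μ) * t) := by
    have := mul_lt_mul_of_pos_left hlt (exp_pos (μ * t))
    refine this.trans_eq ?_
    rw [mul_left_comm, ← exp_add]; ring_nf
  simp only [φ] at h3 h4
  linarith

lemma AbsSubexp.deriv_add {l μ : ℝ} {y y' : ℝ → ℝ} (hμ : -l < μ)
    (hy : ∀ t, HasDerivAt y (y' t) t) (h : AbsSubexp l y) :
    AbsSubexp l (fun t => μ * y t + y' t) := by
  refine ⟨h.1.deriv_add hμ hy, ?_⟩
  have := h.2.deriv_add hμ (fun t => (hy t).neg)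
  exact this.mono fun t => by simp only [Pi.neg_apply]; linarith

/-- A function with `y' ≥ l y - B` that does not grow like `exp (l t)` stays below `B / l`. -/
lemma Subexp.le_div {l B T : ℝ} {y y' : ℝ → ℝ} (hl : 0 < l) (hB : 0 ≤ B)
    (hy : ∀ t, HasDerivAt y (y' t) t) (h : Subexp l y)
    (hineq : ∀ t ≥ T, l * y t - B ≤ y' t) {t : ℝ} (ht : T ≤ t) : y t ≤ B / l := by
  by_contra! hcon
  let φ : ℝ → ℝ := fun s => exp (-l * s) * (y s - B / l)
  have hφ : ∀ s, HasDerivAt φ (exp (-l * s) * (y' s - (l * y s - B))) s := by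
    intro s
    refine ((hasDerivAt_exp_const_mul (-l) s).mul ((hy s).sub_const (B / l))).congr_deriv ?_
    field_simp
    ring
  have hpos : 0 < φ t := mul_pos (exp_pos _) (sub_pos.2 hcon)
  obtain ⟨s, hs, hlt⟩ := h (φ t) hpos t
  have h3 : φ t ≤ φ s := monotone_of_hasDerivAt_nonneg_Ici hφ
    (fun s hs => mul_nonneg (exp_pos _).le (sub_nonneg.2 (hineq s hs))) ht hs
  have h4 : φ s * exp (l * s) = y s - B / l := by
    simp only [φ]
    rw [mul_right_comm, ← exp_add]
    simp
  have h5 := mul_le_mul_of_nonneg_right h3 (exp_pos (l * s)).le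
  have h6 : 0 ≤ B / l := by positivity
  linarith

/-- A sequence of functions each of which is the derivative of its predecessor. -/
def DerivTower (x : ℕ → ℝ → ℝ) : Prop := ∀ k t, HasDerivAt (x k) (x (k + 1) t) t

/-- The operator `a ^ 2 - D ^ 2` on towers. -/
def helm (a : ℝ) (x : ℕ → ℝ → ℝ) : ℕ → ℝ → ℝ := fun k t => a ^ 2 * x k t - x (k + 2) t

/-- The operator `a + D` on towers. -/
def addD (a : ℝ) (x : ℕ → ℝ → ℝ) : ℕ → ℝ → ℝ := fun k t => a * x k t + x (k + 1) t

/-- The operator `a - D` on towers. -/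
def subD (a : ℝ) (x : ℕ → ℝ → ℝ) : ℕ → ℝ → ℝ := fun k t => a * x k t - x (k + 1) t

/-- The tower of `t ↦ exp (s * t) * x 0 t`. -/
def twist (s : ℝ) (x : ℕ → ℝ → ℝ) : ℕ → ℝ → ℝ :=
  fun k t => exp (s * t) * ((addD s)^[k] x) 0 t

/-- The tower of `t ↦ x 0 (-t)`. -/
def reflect (x : ℕ → ℝ → ℝ) : ℕ → ℝ → ℝ := fun k t => (-1) ^ k * x k (-t)

lemma DerivTower.helm {x : ℕ → ℝ → ℝ} (hx : DerivTower x) (a : ℝ) : DerivTower (helm a x) :=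
  fun k t => ((hx k t).const_mul (a ^ 2)).sub (hx (k + 2) t)

lemma DerivTower.addD {x : ℕ → ℝ → ℝ} (hx : DerivTower x) (a : ℝ) : DerivTower (addD a x) :=
  fun k t => ((hx k t).const_mul a).add (hx (k + 1) t)

lemma DerivTower.subD {x : ℕ → ℝ → ℝ} (hx : DerivTower x) (a : ℝ) : DerivTower (subD a x) :=
  fun k t => ((hx k t).const_mul a).sub (hx (k + 1) t)

lemma DerivTower.iterate_addD {x : ℕ → ℝ → ℝ} (hx : DerivTower x) (a : ℝ) (k : ℕ) :
    DerivTower ((_root_.addD a)^[k] x) := by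
  induction k with
  | zero => exact hx
  | succ k ih => rw [Function.iterate_succ_apply']; exact ih.addD a

lemma DerivTower.twist {x : ℕ → ℝ → ℝ} (hx : DerivTower x) (s : ℝ) :
    DerivTower (twist s x) := by
  intro k t
  refine ((hasDerivAt_exp_const_mul s t).mul (hx.iterate_addD s k 0 t)).congr_deriv ?_
  simp only [_root_.twist, Function.iterate_succ_apply']
  simp only [_root_.addD]
  ring

lemma DerivTower.reflect {x : ℕ → ℝ → ℝ} (hx : DerivTower x) : DerivTower (reflect x) := by
  intro k t
  have h := ((hx k (-t)).comp t (hasDerivAt_neg t)).const_mul ((-1 : ℝ) ^ k)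
  refine h.congr_deriv ?_
  simp only [_root_.reflect]
  ring

lemma DerivTower.add {x y : ℕ → ℝ → ℝ} (hx : DerivTower x) (hy : DerivTower y) :
    DerivTower (fun k t => x k t + y k t) := fun k t => (hx k t).add (hy k t)

lemma DerivTower.sub_const_mul {x y : ℕ → ℝ → ℝ} (hx : DerivTower x) (hy : DerivTower y) (r : ℝ) :
    DerivTower (fun k t => x k t - r * y k t) := fun k t => (hx k t).sub ((hy k t).const_mul r)

lemma helm_reflect (a : ℝ) (x : ℕ → ℝ → ℝ) : helm a (reflect x) = reflect (helm a x) := by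
  funext k t
  simp only [helm, reflect]
  ring

lemma AbsSubexp.helm {l μ : ℝ} {x : ℕ → ℝ → ℝ} (hx : DerivTower x) (h : AbsSubexp l (x 0))
    (hμ : |μ| < l) : AbsSubexp l (helm μ x 0) := by
  have h1 := h.deriv_add (μ := μ) (by linarith [neg_abs_le μ]) (hx 0)
  have h2 := h1.deriv_add (μ := -μ) (by linarith [le_abs_self μ]) (hx.addD μ 0)
  refine ⟨h2.2.mono fun t => ?_, h2.1.mono fun t => ?_⟩ <;>
  · simp only [_root_.helm, _root_.addD]
    apply le_of_eq; ring

section SecondOrder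

variable {x : ℕ → ℝ → ℝ} {l : ℝ}

lemma addD_nonneg_of_helm_nonneg (hx : DerivTower x) (hl : 0 < l) (h : AbsSubexp l (x 0))
    (hn : ∀ t, 0 ≤ helm l x 0 t) (t : ℝ) : 0 ≤ addD l x 0 t := by
  have h1 := (h.deriv_add (μ := l) (by linarith) (hx 0)).2
  have h2 := h1.le_div (T := t) hl le_rfl (fun s => (hx.addD l 0 s).neg) (fun s _ => ?_) le_rfl
  · simp only [zero_div, Pi.neg_apply] at h2
    simp only [addD] at h2 ⊢; linarith
  · have := hn s
    simp only [helm, addD, Pi.neg_apply] at this ⊢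
    linarith

lemma reflect_zero (x : ℕ → ℝ → ℝ) (t : ℝ) : reflect x 0 t = x 0 (-t) := by simp [reflect]

lemma subD_nonneg_of_helm_nonneg (hx : DerivTower x) (hl : 0 < l) (h : AbsSubexp l (reflect x 0))
    (hn : ∀ t, 0 ≤ helm l x 0 t) (t : ℝ) : 0 ≤ subD l x 0 t := by
  have := addD_nonneg_of_helm_nonneg hx.reflect hl h
    (fun t => by rw [helm_reflect, reflect_zero]; exact hn _) (-t)
  simpa [addD, subD, reflect, sub_eq_add_neg] using this

lemma nonneg_of_helm_nonneg (hx : DerivTower x) (hl : 0 < l) (h : AbsSubexp l (x 0))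
    (h' : AbsSubexp l (reflect x 0)) (hn : ∀ t, 0 ≤ helm l x 0 t) (t : ℝ) : 0 ≤ x 0 t := by
  have h1 := addD_nonneg_of_helm_nonneg hx hl h hn t
  have h2 := subD_nonneg_of_helm_nonneg hx hl h' hn t
  simp only [addD, subD] at h1 h2
  nlinarith

lemma addD_le_of_helm_le {B : ℝ} (hB : 0 ≤ B) (hx : DerivTower x) (hl : 0 < l)
    (h : AbsSubexp l (x 0)) (hn : ∀ t, helm l x 0 t ≤ B) (t : ℝ) : addD l x 0 t ≤ B / l := by
  have h1 := (h.deriv_add (μ := l) (by linarith) (hx 0)).1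
  refine h1.le_div (T := t) hl hB (fun s => hx.addD l 0 s) (fun s _ => ?_) le_rfl
  have := hn s
  simp only [helm, addD] at this ⊢
  linarith

lemma le_of_helm_le {B : ℝ} (hB : 0 ≤ B) (hx : DerivTower x) (hl : 0 < l)
    (h : AbsSubexp l (x 0)) (h' : AbsSubexp l (reflect x 0)) (hn : ∀ t, helm l x 0 t ≤ B)
    (t : ℝ) : x 0 t ≤ B / l / l := by
  have h1 := addD_le_of_helm_le hB hx hl h hn t
  have h2 := addD_le_of_helm_le hB hx.reflect hl h'
    (fun t => by rw [helm_reflect, reflect_zero]; exact hn _) (-t)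
  simp only [addD, reflect, neg_neg] at h1 h2
  rw [le_div_iff₀ hl]
  linarith

/-- Decay of the solution of `(l ^ 2 - D ^ 2) x = O(exp (-μ t))` when `l < μ`. -/
lemma exp_decay_of_helm_le {C μ T : ℝ} (hC : 0 ≤ C) (hx : DerivTower x) (hl : 0 < l) (hμ : l < μ)
    (h : Subexp l (x 0)) (hn : ∀ t ≥ T, helm l x 0 t ≤ C * exp (-μ * t)) :
    ∃ C' ≥ 0, ∀ t ≥ T, addD l x 0 t ≤ C' * exp (-μ * t) ∧ x 0 t ≤ C' * exp (-l * t) := by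
  have h1 := h.deriv_add (μ := l) (by linarith) (hx 0)
  have hA : ∀ t ≥ T, addD l x 0 t ≤ C / (l + μ) * exp (-μ * t) := by
    intro t ht
    let r : ℝ → ℝ := fun t => addD l x 0 t - C / (l + μ) * exp (-μ * t)
    have hr : ∀ t, HasDerivAt r (addD l x 1 t - C / (l + μ) * (-μ * exp (-μ * t))) t := fun t =>
      (hx.addD l 0 t).sub ((hasDerivAt_exp_const_mul (-μ) t).const_mul _)
    have hrs : Subexp l r := h1.mono fun t => by
      have : 0 ≤ C / (l + μ) * exp (-μ * t) := by
        have : 0 < l + μ := by linarith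
        positivity
      simp only [r, addD]; linarith
    have := hrs.le_div (T := T) hl le_rfl hr (fun s hs => ?_) ht
    · simp only [zero_div, r] at this; linarith
    · have h2 := hn s hs
      have h3 : C * exp (-μ * s) = (l + μ) * (C / (l + μ) * exp (-μ * s)) := by
        have : l + μ ≠ 0 := by linarith
        field_simp
      simp only [helm, addD, r] at h2 ⊢
      rw [h3] at h2
      linarith
  set K := C / (l + μ) with hK
  have hK0 : 0 ≤ K := by
    have : 0 < l + μ := by linarith
    positivity
  let φ : ℝ → ℝ := fun t => - (exp (l * t) * x 0 t + K / (μ - l) * exp (-(μ - l) * t))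
  have hμl : 0 < μ - l := by linarith
  have hφ : ∀ t, HasDerivAt φ (exp (l * t) * (K * exp (-μ * t) - addD l x 0 t)) t := by
    intro t
    refine (((hasDerivAt_exp_const_mul l t).mul (hx 0 t)).add
      ((hasDerivAt_exp_const_mul (-(μ - l)) t).const_mul (K / (μ - l)))).neg.congr_deriv ?_
    have h2 : exp (-(μ - l) * t) = exp (l * t) * exp (-μ * t) := by
      rw [← exp_add]; ring_nf
    rw [h2]
    simp only [addD]
    field_simp
    ring
  have hB : ∀ t ≥ T, x 0 t ≤ |φ T| * exp (-l * t) := by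
    intro t ht
    have h3 : φ T ≤ φ t := monotone_of_hasDerivAt_nonneg_Ici hφ
      (fun s hs => mul_nonneg (exp_pos _).le (sub_nonneg.2 (hA s hs))) le_rfl ht
    have h4 : exp (l * t) * x 0 t ≤ |φ T| := by
      have h5 : 0 ≤ K / (μ - l) * exp (-(μ - l) * t) := by positivity
      have h6 := neg_le_abs (φ T)
      have h7 : φ t = - (exp (l * t) * x 0 t + K / (μ - l) * exp (-(μ - l) * t)) := rfl
      linarith
    have h8 := mul_le_mul_of_nonneg_right h4 (exp_pos (-l * t)).le
    rwa [mul_right_comm, ← exp_add, ← add_mul, add_neg_cancel, zero_mul, exp_zero, one_mul] at h8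
  refine ⟨max K |φ T|, le_max_of_le_left hK0, fun t ht => ⟨(hA t ht).trans ?_, (hB t ht).trans ?_⟩⟩
  · exact mul_le_mul_of_nonneg_right (le_max_left _ _) (exp_pos _).le
  · exact mul_le_mul_of_nonneg_right (le_max_right _ _) (exp_pos _).le

/-- A function with `x'' ≥ l ^ 2 x` near infinity and no exponential growth decays. -/
lemma exp_decay_of_helm_nonpos {T : ℝ} (hx : DerivTower x) (hl : 0 < l) (h : Subexp l (x 0))
    (hn : ∀ t ≥ T, helm l x 0 t ≤ 0) : ∃ C ≥ 0, ∀ t ≥ T, x 0 t ≤ C * exp (-l * t) := by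
  have h1 := h.deriv_add (μ := l) (by linarith) (hx 0)
  have hA : ∀ t ≥ T, addD l x 0 t ≤ 0 := by
    intro t ht
    have := h1.le_div (T := T) hl le_rfl (hx.addD l 0) (fun s hs => ?_) ht
    · simpa using this
    · have h2 := hn s hs
      simp only [helm, addD] at h2 ⊢
      linarith
  let φ : ℝ → ℝ := fun t => - (exp (l * t) * x 0 t)
  have hφ : ∀ t, HasDerivAt φ (exp (l * t) * (- addD l x 0 t)) t := by
    intro t
    refine ((hasDerivAt_exp_const_mul l t).mul (hx 0 t)).neg.congr_deriv ?_
    simp only [addD]; ring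
  refine ⟨|φ T|, abs_nonneg _, fun t ht => ?_⟩
  have h3 : φ T ≤ φ t := monotone_of_hasDerivAt_nonneg_Ici hφ
    (fun s hs => mul_nonneg (exp_pos _).le (neg_nonneg.2 (hA s hs))) le_rfl ht
  have h4 : exp (l * t) * x 0 t ≤ |φ T| := by
    have h6 := neg_le_abs (φ T)
    have h7 : φ t = - (exp (l * t) * x 0 t) := rfl
    linarith
  have h8 := mul_le_mul_of_nonneg_right h4 (exp_pos (-l * t)).le
  rwa [mul_right_comm, ← exp_add, ← add_mul, add_neg_cancel, zero_mul, exp_zero, one_mul] at h8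

end SecondOrder

section SixthOrder

variable {x : ℕ → ℝ → ℝ} {a b c σ C : ℝ}

lemma AbsSubexp.of_abs_le_exp_abs {l : ℝ} (hσ : σ < l)
    (h : ∀ t, |x 0 t| ≤ C * exp (σ * |t|)) :
    AbsSubexp l (x 0) ∧ AbsSubexp l (reflect x 0) := by
  refine ⟨absSubexp_of_abs_le_exp (C := C) hσ fun t ht => ?_,
    absSubexp_of_abs_le_exp (C := C) hσ fun t ht => ?_⟩
  · simpa [abs_of_nonneg ht] using h t
  · simpa [abs_of_nonneg ht, reflect_zero] using h (-t)

lemma AbsSubexp.helm_pair {l μ : ℝ} (hx : DerivTower x) (hμ : |μ| < l)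
    (h : AbsSubexp l (x 0) ∧ AbsSubexp l (reflect x 0)) :
    AbsSubexp l (_root_.helm μ x 0) ∧ AbsSubexp l (reflect (_root_.helm μ x) 0) := by
  refine ⟨h.1.helm hx hμ, ?_⟩
  rw [← helm_reflect]
  exact h.2.helm hx.reflect hμ

lemma helm_helm_nonneg (hx : DerivTower x) (ha : 0 < a) (hab : a < b) (hbc : b < c)
    (hσ : σ < a) (h : ∀ t, |x 0 t| ≤ C * exp (σ * |t|))
    (hn : ∀ t, 0 ≤ helm c (helm b (helm a x)) 0 t) (t : ℝ) : 0 ≤ helm b (helm a x) 0 t := by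
  have hc := AbsSubexp.of_abs_le_exp_abs (l := c) (by linarith) h
  have hc1 := AbsSubexp.helm_pair hx (by rw [abs_of_pos ha]; linarith) hc
  have hc2 := AbsSubexp.helm_pair (hx.helm a) (by rw [abs_of_pos (ha.trans hab)]; linarith) hc1
  exact nonneg_of_helm_nonneg ((hx.helm a).helm b) (by linarith) hc2.1 hc2.2 hn t

lemma helm_nonneg (hx : DerivTower x) (ha : 0 < a) (hab : a < b) (hbc : b < c)
    (hσ : σ < a) (h : ∀ t, |x 0 t| ≤ C * exp (σ * |t|))
    (hn : ∀ t, 0 ≤ helm c (helm b (helm a x)) 0 t) (t : ℝ) : 0 ≤ helm a x 0 t := by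
  have hb := AbsSubexp.of_abs_le_exp_abs (l := b) (by linarith) h
  have hb1 := AbsSubexp.helm_pair hx (by rwa [abs_of_pos ha]) hb
  exact nonneg_of_helm_nonneg (hx.helm a) (by linarith) hb1.1 hb1.2
    (helm_helm_nonneg hx ha hab hbc hσ h hn) t

lemma addD_nonneg_and_subD_nonneg (hx : DerivTower x) (ha : 0 < a) (hab : a < b) (hbc : b < c)
    (hσ : σ < a) (h : ∀ t, |x 0 t| ≤ C * exp (σ * |t|))
    (hn : ∀ t, 0 ≤ helm c (helm b (helm a x)) 0 t) (t : ℝ) :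
    0 ≤ addD a x 0 t ∧ 0 ≤ subD a x 0 t := by
  have h1 := AbsSubexp.of_abs_le_exp_abs hσ h
  have h2 := helm_nonneg hx ha hab hbc hσ h hn
  exact ⟨addD_nonneg_of_helm_nonneg hx ha h1.1 h2 t, subD_nonneg_of_helm_nonneg hx ha h1.2 h2 t⟩

lemma helm_helm_le {B : ℝ} (hB : 0 ≤ B) (hx : DerivTower x) (ha : 0 < a) (hab : a < b)
    (hbc : b < c) (hσ : σ < a) (h : ∀ t, |x 0 t| ≤ C * exp (σ * |t|))
    (hn : ∀ t, helm c (helm b (helm a x)) 0 t ≤ B) (t : ℝ) :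
    helm b (helm a x) 0 t ≤ B / c / c := by
  have hc := AbsSubexp.of_abs_le_exp_abs (l := c) (by linarith) h
  have hc1 := AbsSubexp.helm_pair hx (by rw [abs_of_pos ha]; linarith) hc
  have hc2 := AbsSubexp.helm_pair (hx.helm a) (by rw [abs_of_pos (ha.trans hab)]; linarith) hc1
  exact le_of_helm_le hB ((hx.helm a).helm b) (by linarith) hc2.1 hc2.2 hn t

lemma helm_le {B : ℝ} (hB : 0 ≤ B) (hx : DerivTower x) (ha : 0 < a) (hab : a < b)
    (hbc : b < c) (hσ : σ < a) (h : ∀ t, |x 0 t| ≤ C * exp (σ * |t|))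
    (hn : ∀ t, helm c (helm b (helm a x)) 0 t ≤ B) (t : ℝ) :
    helm a x 0 t ≤ B / c / c / b / b := by
  have hb := AbsSubexp.of_abs_le_exp_abs (l := b) (by linarith) h
  have hb1 := AbsSubexp.helm_pair hx (by rwa [abs_of_pos ha]) hb
  have hb0 : 0 < b := by linarith
  have hc0 : 0 < c := by linarith
  exact le_of_helm_le (by positivity) (hx.helm a) hb0 hb1.1 hb1.2
    (helm_helm_le hB hx ha hab hbc hσ h hn) t

/-- A nonzero nonnegative function whose image under the sixth order operator is nonnegative
is bounded below by a positive multiple of `exp (-a |t|)`. -/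
lemma exists_mul_exp_neg_abs_le (hx : DerivTower x) (ha : 0 < a) (hab : a < b) (hbc : b < c)
    (hσ : σ < a) (h : ∀ t, |x 0 t| ≤ C * exp (σ * |t|))
    (hn : ∀ t, 0 ≤ helm c (helm b (helm a x)) 0 t) {t₀ : ℝ} (ht₀ : 0 < x 0 t₀) :
    ∃ δ > 0, ∀ t, δ * exp (-a * |t|) ≤ x 0 t := by
  have hs := addD_nonneg_and_subD_nonneg hx ha hab hbc hσ h hn
  have h1 : Monotone fun t => exp (a * t) * x 0 t := by
    refine monotone_of_hasDerivAt_nonneg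
      (fun t => (hasDerivAt_exp_const_mul a t).mul (hx 0 t)) fun t => ?_
    have := mul_nonneg (exp_pos (a * t)).le (hs t).1
    simp only [addD] at this
    simp only [Pi.zero_apply]
    linarith
  have h2 : Antitone fun t => exp (-a * t) * x 0 t := by
    refine antitone_of_hasDerivAt_nonpos
      (fun t => (hasDerivAt_exp_const_mul (-a) t).mul (hx 0 t)) fun t => ?_
    have := mul_nonneg (exp_pos (-a * t)).le (hs t).2
    simp only [subD] at this
    simp only [Pi.zero_apply]
    linarith
  refine ⟨exp (-a * |t₀|) * x 0 t₀, by positivity, fun t => ?_⟩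
  rcases le_total t₀ t with htt | htt
  · have h3 : exp (a * t₀) * x 0 t₀ ≤ exp (a * t) * x 0 t := h1 htt
    have h4 := mul_le_mul_of_nonneg_left h3 (exp_pos (-a * t)).le
    rw [← mul_assoc, ← mul_assoc, ← exp_add, ← exp_add, neg_mul, neg_add_cancel, exp_zero,
      one_mul] at h4
    refine le_trans ?_ h4
    rw [mul_right_comm, ← exp_add]
    refine mul_le_mul_of_nonneg_right (exp_le_exp.2 ?_) ht₀.le
    nlinarith [neg_abs_le t₀, le_abs_self t]
  · have h3 : exp (-a * t₀) * x 0 t₀ ≤ exp (-a * t) * x 0 t := h2 htt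
    have h4 := mul_le_mul_of_nonneg_left h3 (exp_pos (a * t)).le
    rw [← mul_assoc, ← mul_assoc, ← exp_add, ← exp_add, neg_mul, neg_mul, add_neg_cancel, exp_zero,
      one_mul] at h4
    refine le_trans ?_ h4
    rw [mul_right_comm, ← exp_add]
    refine mul_le_mul_of_nonneg_right (exp_le_exp.2 ?_) ht₀.le
    nlinarith [le_abs_self t₀, neg_abs_le t]

end SixthOrder

/-- The derivative tower of a bounded positive homoclinic solution of
`(α² - D²)((α + 2)² - D²)((α + 4)² - D²) v = c v ^ (6 / α) v`. -/
structure IsHomoclinic (α c : ℝ) (x : ℕ → ℝ → ℝ) : Prop where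
  tower : DerivTower x
  alpha_pos : 0 < α
  c_pos : 0 < c
  pos : ∀ t, 0 < x 0 t
  bounded : ∃ M, ∀ t, x 0 t ≤ M
  tendsto_atTop : Tendsto (x 0) atTop (nhds 0)
  tendsto_atBot : Tendsto (x 0) atBot (nhds 0)
  eq : ∀ t, helm (α + 4) (helm (α + 2) (helm α x)) 0 t = c * (x 0 t) ^ (6 / α) * x 0 t

namespace IsHomoclinic

variable {α c : ℝ} {x : ℕ → ℝ → ℝ}

lemma reflect (h : IsHomoclinic α c x) : IsHomoclinic α c (reflect x) where
  tower := h.tower.reflect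
  alpha_pos := h.alpha_pos
  c_pos := h.c_pos
  pos t := by rw [reflect_zero]; exact h.pos _
  bounded := h.bounded.imp fun M hM t => by rw [reflect_zero]; exact hM _
  tendsto_atTop := by
    simp only [funext (reflect_zero x)]
    exact h.tendsto_atBot.comp tendsto_neg_atTop_atBot
  tendsto_atBot := by
    simp only [funext (reflect_zero x)]
    exact h.tendsto_atTop.comp tendsto_neg_atBot_atTop
  eq t := by
    rw [helm_reflect, helm_reflect, helm_reflect, reflect_zero, reflect_zero]
    exact h.eq _

lemma abs_le (h : IsHomoclinic α c x) {M : ℝ} (hM : ∀ t, x 0 t ≤ M) (t : ℝ) :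
    |x 0 t| ≤ M * exp (0 * |t|) := by
  simpa [abs_of_pos (h.pos t)] using hM t

lemma rhs_nonneg (h : IsHomoclinic α c x) (t : ℝ) :
    0 ≤ helm (α + 4) (helm (α + 2) (helm α x)) 0 t := by
  rw [h.eq]
  have := h.pos t
  have := h.c_pos
  positivity

lemma helm_nonneg (h : IsHomoclinic α c x) (t : ℝ) : 0 ≤ helm α x 0 t := by
  obtain ⟨M, hM⟩ := h.bounded
  exact _root_.helm_nonneg h.tower h.alpha_pos (by linarith) (by linarith) h.alpha_pos
    (h.abs_le hM) h.rhs_nonneg t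

lemma helm_helm_nonneg (h : IsHomoclinic α c x) (t : ℝ) : 0 ≤ helm (α + 2) (helm α x) 0 t := by
  obtain ⟨M, hM⟩ := h.bounded
  exact _root_.helm_helm_nonneg h.tower h.alpha_pos (by linarith) (by linarith) h.alpha_pos
    (h.abs_le hM) h.rhs_nonneg t

lemma addD_nonneg (h : IsHomoclinic α c x) (t : ℝ) : 0 ≤ addD α x 0 t := by
  obtain ⟨M, hM⟩ := h.bounded
  exact (addD_nonneg_and_subD_nonneg h.tower h.alpha_pos (by linarith) (by linarith) h.alpha_pos
    (h.abs_le hM) h.rhs_nonneg t).1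

lemma subD_nonneg (h : IsHomoclinic α c x) (t : ℝ) : 0 ≤ subD α x 0 t := by
  obtain ⟨M, hM⟩ := h.bounded
  exact (addD_nonneg_and_subD_nonneg h.tower h.alpha_pos (by linarith) (by linarith) h.alpha_pos
    (h.abs_le hM) h.rhs_nonneg t).2

lemma rhs_bounded (h : IsHomoclinic α c x) :
    ∃ B ≥ 0, ∀ t, helm (α + 4) (helm (α + 2) (helm α x)) 0 t ≤ B := by
  obtain ⟨M, hM⟩ := h.bounded
  have hM0 : 0 < M := (h.pos 0).trans_le (hM 0)
  have hc := h.c_pos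
  have hα := h.alpha_pos
  refine ⟨c * M ^ (6 / α) * M, by positivity, fun t => ?_⟩
  rw [h.eq]
  have hp := h.pos t
  gcongr
  · exact hM t
  · exact hM t

lemma exists_bound (h : IsHomoclinic α c x) :
    ∃ B, ∀ t, helm α x 0 t ≤ B ∧ helm (α + 2) (helm α x) 0 t ≤ B := by
  obtain ⟨M, hM⟩ := h.bounded
  obtain ⟨B, hB, hle⟩ := h.rhs_bounded
  exact ⟨_, fun t =>
    ⟨(helm_le hB h.tower h.alpha_pos (by linarith) (by linarith) h.alpha_pos
      (h.abs_le hM) hle t).trans (le_max_left _ _),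
    (helm_helm_le hB h.tower h.alpha_pos (by linarith) (by linarith) h.alpha_pos
      (h.abs_le hM) hle t).trans (le_max_right _ _)⟩⟩

lemma exists_exp_decay (h : IsHomoclinic α c x) {δ : ℝ} (hδ : 0 < δ) (hδα : δ < α) :
    ∃ C ≥ 0, ∃ T, ∀ t ≥ T, x 0 t ≤ C * exp (-δ * t) := by
  have hα := h.alpha_pos
  obtain ⟨M, hM⟩ := h.bounded
  obtain ⟨B, hB⟩ := h.exists_bound
  have hlim : Tendsto (fun t => c * (x 0 t) ^ (6 / α)) atTop (nhds 0) := by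
    have := (h.tendsto_atTop.rpow_const (p := 6 / α) (Or.inr (by positivity))).const_mul c
    rwa [zero_rpow (by positivity), mul_zero] at this
  have hε : 0 < α ^ 2 - δ ^ 2 := by nlinarith
  obtain ⟨T, hT⟩ := eventually_atTop.1 (hlim.eventually_lt_const hε)
  let y : ℕ → ℝ → ℝ := fun k t => (x k t + helm α x k t) + helm (α + 2) (helm α x) k t
  have hy : DerivTower y :=
    (h.tower.add (h.tower.helm α)).add ((h.tower.helm α).helm (α + 2))
  have hsub : Subexp δ (y 0) := by
    refine subexp_of_le_exp (σ := 0) (C := M + B + B) hδ fun t _ => ?_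
    have := hM t
    have := hB t
    simp only [y, zero_mul, exp_zero, mul_one]
    linarith
  obtain ⟨C, hC, hle⟩ := exp_decay_of_helm_nonpos (T := T) hy hδ hsub fun t ht => by
    have h1 := h.eq t
    have h2 := mul_le_mul_of_nonneg_right (hT t ht).le (h.pos t).le
    have h3 := h.helm_nonneg t
    have h4 := h.helm_helm_nonneg t
    rw [← h1] at h2
    have e : helm δ y 0 t = (δ ^ 2 - α ^ 2) * x 0 t + (δ ^ 2 - (α + 2) ^ 2 + 1) * helm α x 0 t
        + (δ ^ 2 - (α + 4) ^ 2 + 1) * helm (α + 2) (helm α x) 0 t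
        + helm (α + 4) (helm (α + 2) (helm α x)) 0 t := by
      simp only [y, helm]; ring
    rw [e]
    have h5 := mul_nonneg (show 0 ≤ (α + 2) ^ 2 - δ ^ 2 - 1 by nlinarith) h3
    have h6 := mul_nonneg (show 0 ≤ (α + 4) ^ 2 - δ ^ 2 - 1 by nlinarith) h4
    linarith
  refine ⟨C, hC, T, fun t ht => (le_trans ?_ (hle t ht))⟩
  have := h.helm_nonneg t
  have := h.helm_helm_nonneg t
  simp only [y]
  linarith

lemma exists_exp_decay_sharp (h : IsHomoclinic α c x) :
    ∃ C ≥ 0, ∃ T, ∀ t ≥ T, addD α x 0 t ≤ C * exp (-(α + 2) * t) ∧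
      x 0 t ≤ C * exp (-α * t) := by
  have hα := h.alpha_pos
  have hc := h.c_pos
  obtain ⟨M, hM⟩ := h.bounded
  obtain ⟨B, hB⟩ := h.exists_bound
  let δ := α * (α + 5) / (α + 6)
  have hδ : 0 < δ := by positivity
  have hδα : δ < α := by
    rw [div_lt_iff₀ (by positivity)]; nlinarith
  obtain ⟨C, hC, T, hT⟩ := h.exists_exp_decay hδ hδα
  have hF : ∀ t ≥ T, helm (α + 4) (helm (α + 2) (helm α x)) 0 t ≤
      (c * C ^ (6 / α) * C) * exp (-(α + 5) * t) := by
    intro t ht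
    rw [h.eq]
    have hp := h.pos t
    have h1 : c * (x 0 t) ^ (6 / α) * x 0 t ≤
        c * (C * exp (-δ * t)) ^ (6 / α) * (C * exp (-δ * t)) := by
      gcongr
      · exact hT t ht
      · exact hT t ht
    refine h1.trans_eq ?_
    rw [mul_rpow hC (exp_pos _).le, ← exp_mul]
    have h2 : -(α + 5) * t = -δ * t * (6 / α) + -δ * t := by
      simp only [δ]; field_simp; ring
    rw [h2, exp_add]
    ring
  have hsub : ∀ {l B : ℝ} {y : ℝ → ℝ}, 0 < l → (∀ t, y t ≤ B) → Subexp l y :=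
    fun {l B y} hl hy => subexp_of_le_exp (σ := 0) (C := B) hl fun t _ => by simpa using hy t
  obtain ⟨C₁, hC₁, h₁⟩ := exp_decay_of_helm_le (by positivity) ((h.tower.helm α).helm (α + 2))
    (by positivity) (by linarith) (hsub (by positivity) fun t => (hB t).2) hF
  obtain ⟨C₂, hC₂, h₂⟩ := exp_decay_of_helm_le hC₁ (h.tower.helm α)
    (by positivity) (by linarith) (hsub (by positivity) fun t => (hB t).1) fun t ht => (h₁ t ht).2
  obtain ⟨C₃, hC₃, h₃⟩ := exp_decay_of_helm_le hC₂ h.tower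
    (by positivity) (by linarith) (hsub (by positivity) hM) fun t ht => (h₂ t ht).2
  exact ⟨C₃, hC₃, T, h₃⟩

lemma addD_le_of_bounded (h : IsHomoclinic α c x) {M : ℝ} (hM : ∀ t, x 0 t ≤ M) (t : ℝ) :
    addD α x 0 t ≤ 2 * α * M := by
  have h1 := h.subD_nonneg t
  have h2 := mul_le_mul_of_nonneg_left (hM t) h.alpha_pos.le
  simp only [subD, addD] at h1 ⊢
  linarith

lemma exists_exp_decay_Ici (h : IsHomoclinic α c x) :
    ∃ C ≥ 0, ∀ t ≥ 0, addD α x 0 t ≤ C * exp (-(α + 2) * t) ∧ x 0 t ≤ C * exp (-α * t) := by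
  have hα := h.alpha_pos
  obtain ⟨M, hM⟩ := h.bounded
  have hM0 : 0 < M := (h.pos 0).trans_le (hM 0)
  obtain ⟨C, hC, T, hT⟩ := h.exists_exp_decay_sharp
  have key : ∀ {l B y t : ℝ}, 0 < l → 0 ≤ B → y ≤ B → t ≤ T →
      y ≤ B * exp (l * T) * exp (-l * t) := by
    intro l B y t hl hB hy ht
    refine hy.trans ?_
    rw [mul_assoc, ← exp_add]
    refine le_mul_of_one_le_right hB (one_le_exp ?_)
    nlinarith
  refine ⟨max C (max (2 * α * M * exp ((α + 2) * T)) (M * exp (α * T))), le_max_of_le_left hC,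
    fun t _ => ?_⟩
  rcases le_total T t with ht | ht
  · have := hT t ht
    exact ⟨this.1.trans (mul_le_mul_of_nonneg_right (le_max_left _ _) (exp_pos _).le),
      this.2.trans (mul_le_mul_of_nonneg_right (le_max_left _ _) (exp_pos _).le)⟩
  · refine ⟨(key (by positivity) (by positivity) (h.addD_le_of_bounded hM t) ht).trans
      (mul_le_mul_of_nonneg_right ?_ (exp_pos _).le),
      (key hα hM0.le (hM t) ht).trans (mul_le_mul_of_nonneg_right ?_ (exp_pos _).le)⟩
    · exact (le_max_left _ _).trans (le_max_right _ _)
    · exact (le_max_right _ _).trans (le_max_right _ _)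

lemma exists_twist_addD_le (h : IsHomoclinic α c x) :
    ∃ M > 0, ∀ t, exp t * addD α x 0 t ≤ M * exp (-(α + 1) * |t|) := by
  have hα := h.alpha_pos
  obtain ⟨C, hC, hle⟩ := h.exists_exp_decay_Ici
  obtain ⟨C', hC', hle'⟩ := h.reflect.exists_exp_decay_Ici
  refine ⟨C + 2 * α * C' + 1, by positivity, fun t => ?_⟩
  rcases le_total 0 t with ht | ht
  · have h1 := mul_le_mul_of_nonneg_left (hle t ht).1 (exp_pos t).le
    rw [mul_left_comm, ← exp_add] at h1
    rw [abs_of_nonneg ht]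
    refine h1.trans ?_
    rw [show t + -(α + 2) * t = -(α + 1) * t by ring]
    refine mul_le_mul_of_nonneg_right ?_ (exp_pos _).le
    have : 0 ≤ 2 * α * C' := by positivity
    linarith
  · have h1 := (hle' (-t) (by linarith)).2
    rw [reflect_zero, neg_neg] at h1
    have h2 : addD α x 0 t ≤ 2 * α * C' * exp (-α * -t) := by
      have h3 := h.subD_nonneg t
      have h4 := mul_le_mul_of_nonneg_left h1 hα.le
      simp only [subD, addD] at h3 ⊢
      linarith
    have h5 := mul_le_mul_of_nonneg_left h2 (exp_pos t).le
    rw [mul_left_comm, ← exp_add] at h5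
    rw [abs_of_nonpos ht]
    refine h5.trans ?_
    rw [show t + -α * -t = -(α + 1) * -t by ring]
    refine mul_le_mul_of_nonneg_right ?_ (exp_pos _).le
    linarith

lemma eq_deriv (h : IsHomoclinic α c x) (t : ℝ) :
    helm (α + 4) (helm (α + 2) (helm α x)) 1 t =
      (1 + 6 / α) * (c * (x 0 t) ^ (6 / α)) * x 1 t := by
  have h1 := (((h.tower.helm α).helm (α + 2)).helm (α + 4)) 0 t
  rw [funext h.eq] at h1
  have hp := h.pos t
  have h2 := ((((h.tower 0 t).rpow_const (p := 6 / α) (Or.inl hp.ne')).const_mul c).mul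
    (h.tower 0 t))
  rw [h1.unique h2]
  rw [rpow_sub_one hp.ne']
  field_simp
  ring

lemma helm_twist_subD (h : IsHomoclinic α c x) (t : ℝ) :
    helm (α + 5) (helm (α + 3) (helm (α + 1) (twist (-1) (subD α x)))) 0 t =
      (1 + 6 / α) * (c * (x 0 t) ^ (6 / α)) * twist (-1) (subD α x) 0 t := by
  have h0 := h.eq t
  have h1 := h.eq_deriv t
  have hα := h.alpha_pos.ne'
  have h2 : (1 + 6 / α) * (c * (x 0 t) ^ (6 / α)) * (α * x 0 t) =
      (α + 6) * (c * (x 0 t) ^ (6 / α) * x 0 t) := by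
    field_simp
  have e : helm (α + 5) (helm (α + 3) (helm (α + 1) (twist (-1) (subD α x)))) 0 t =
      exp (-1 * t) * ((α + 6) * helm (α + 4) (helm (α + 2) (helm α x)) 0 t
        - helm (α + 4) (helm (α + 2) (helm α x)) 1 t) := by
    simp only [helm, twist, Function.iterate_succ_apply, Function.iterate_zero, id, addD, subD,
      zero_add, Nat.reduceAdd]
    ring
  rw [e, h0, h1]
  simp only [twist, Function.iterate_zero, id, subD]
  linear_combination -exp (-1 * t) * h2

lemma helm_twist_addD (h : IsHomoclinic α c x) (t : ℝ) :
    helm (α + 5) (helm (α + 3) (helm (α + 1) (twist 1 (addD α x)))) 0 t =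
      (1 + 6 / α) * (c * (x 0 t) ^ (6 / α)) * twist 1 (addD α x) 0 t := by
  have h0 := h.eq t
  have h1 := h.eq_deriv t
  have hα := h.alpha_pos.ne'
  have h2 : (1 + 6 / α) * (c * (x 0 t) ^ (6 / α)) * (α * x 0 t) =
      (α + 6) * (c * (x 0 t) ^ (6 / α) * x 0 t) := by
    field_simp
  have e : helm (α + 5) (helm (α + 3) (helm (α + 1) (twist 1 (addD α x)))) 0 t =
      exp (1 * t) * ((α + 6) * helm (α + 4) (helm (α + 2) (helm α x)) 0 t
        + helm (α + 4) (helm (α + 2) (helm α x)) 1 t) := by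
    simp only [helm, twist, Function.iterate_succ_apply, Function.iterate_zero, id, addD,
      zero_add, Nat.reduceAdd]
    ring
  rw [e, h0, h1]
  simp only [twist, Function.iterate_zero, id, addD]
  linear_combination -exp (1 * t) * h2

lemma twist_subD_zero (a s t : ℝ) (x : ℕ → ℝ → ℝ) :
    twist s (subD a x) 0 t = exp (s * t) * (a * x 0 t - x 1 t) := rfl

lemma twist_addD_zero (a s t : ℝ) (x : ℕ → ℝ → ℝ) :
    twist s (addD a x) 0 t = exp (s * t) * (a * x 0 t + x 1 t) := rfl

/-- The two positive solutions of the linearized equation coming from translations and special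
conformal transformations coincide when the critical point is at the origin. -/
lemma twist_subD_eq_twist_addD (h : IsHomoclinic α c x) (h0 : x 1 0 = 0) (t : ℝ) :
    twist (-1) (subD α x) 0 t = twist 1 (addD α x) 0 t := by
  have hα := h.alpha_pos
  have hc := h.c_pos
  obtain ⟨M₀, hM₀⟩ := h.bounded
  obtain ⟨M, hM, hle⟩ := h.exists_twist_addD_le
  let ψ := twist (-1) (subD α x)
  let η := twist 1 (addD α x)
  have hψ : ∀ t, 0 ≤ ψ 0 t := fun t => mul_nonneg (exp_pos _).le (h.subD_nonneg t)
  have hη : ∀ t, 0 ≤ η 0 t := fun t => mul_nonneg (exp_pos _).le (h.addD_nonneg t)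
  have hψ0 : ψ 0 0 = α * x 0 0 := by simp [ψ, twist_subD_zero, h0]
  have hη0 : η 0 0 = α * x 0 0 := by simp [η, twist_addD_zero, h0]
  have hpos0 : 0 < α * x 0 0 := mul_pos hα (h.pos 0)
  have hηle : ∀ t, η 0 t ≤ M * exp (-(α + 1) * |t|) := fun t => by
    have := hle t
    simpa [η, twist_addD_zero, addD] using this
  let S : Set ℝ := {r | 0 ≤ r ∧ ∀ t, r * η 0 t ≤ ψ 0 t}
  have hSbdd : BddAbove S := ⟨1, fun r hr => by
    have := hr.2 0
    rw [hψ0, hη0] at this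
    nlinarith⟩
  have hS0 : (0 : ℝ) ∈ S := ⟨le_rfl, fun t => by simpa using hψ t⟩
  have hSclosed : IsClosed S := by
    have : S = Set.Ici 0 ∩ ⋂ t, {r | r * η 0 t ≤ ψ 0 t} := by
      ext r; simp [S]
    rw [this]
    exact isClosed_Ici.inter (isClosed_iInter fun t =>
      isClosed_le (continuous_id.mul continuous_const) continuous_const)
  set ρ := sSup S
  have hρ : ρ ∈ S := hSclosed.csSup_mem ⟨0, hS0⟩ hSbdd
  let χ : ℕ → ℝ → ℝ := fun k t => ψ k t - ρ * η k t
  have hχ : DerivTower χ :=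
    ((h.tower.subD α).twist (-1)).sub_const_mul ((h.tower.addD α).twist 1) ρ
  have hχ0 : ∀ t, 0 ≤ χ 0 t := fun t => sub_nonneg.2 (hρ.2 t)
  have hχle : ∀ t, |χ 0 t| ≤ 2 * α * M₀ * exp (1 * |t|) := by
    intro t
    rw [abs_of_nonneg (hχ0 t)]
    have h1 : χ 0 t ≤ ψ 0 t := by
      have := mul_nonneg hρ.1 (hη t)
      simp only [χ]; linarith
    refine h1.trans ?_
    have h2 : α * x 0 t - x 1 t ≤ 2 * α * M₀ := by
      have h3 := h.addD_nonneg t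
      have h4 := mul_le_mul_of_nonneg_left (hM₀ t) hα.le
      simp only [addD] at h3
      linarith
    have h3 := h.subD_nonneg t
    simp only [ψ, twist_subD_zero]
    rw [mul_comm]
    refine mul_le_mul h2 (exp_le_exp.2 ?_) (exp_pos _).le (h3.trans h2)
    linarith [neg_abs_le t]
  have hχeq : ∀ t, helm (α + 5) (helm (α + 3) (helm (α + 1) χ)) 0 t =
      (1 + 6 / α) * (c * (x 0 t) ^ (6 / α)) * χ 0 t := by
    intro t
    have h1 := h.helm_twist_subD t
    have h2 := h.helm_twist_addD t
    have e : helm (α + 5) (helm (α + 3) (helm (α + 1) χ)) 0 t =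
        helm (α + 5) (helm (α + 3) (helm (α + 1) ψ)) 0 t
          - ρ * helm (α + 5) (helm (α + 3) (helm (α + 1) η)) 0 t := by
      simp only [helm, χ]; ring
    rw [e, h1, h2]
    simp only [χ, ψ, η]
    ring
  have hχn : ∀ t, 0 ≤ helm (α + 5) (helm (α + 3) (helm (α + 1) χ)) 0 t := by
    intro t
    rw [hχeq]
    have := h.pos t
    have := hχ0 t
    positivity
  have hzero : ∀ t, χ 0 t = 0 := by
    by_contra! hne
    obtain ⟨t₀, ht₀⟩ := hne
    obtain ⟨δ, hδ, hδle⟩ := exists_mul_exp_neg_abs_le hχ (by linarith) (by linarith) (by linarith)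
      (by linarith) hχle hχn (lt_of_le_of_ne (hχ0 t₀) ht₀.symm)
    have hmem : ρ + δ / M ∈ S := by
      refine ⟨add_nonneg hρ.1 (by positivity), fun t => ?_⟩
      have h1 := hδle t
      have h2 := mul_le_mul_of_nonneg_left (hηle t) (div_nonneg hδ.le hM.le)
      rw [← mul_assoc, div_mul_cancel₀ _ hM.ne'] at h2
      simp only [χ] at h1
      linarith
    have := le_csSup hSbdd hmem
    have : 0 < δ / M := by positivity
    linarith
  have hρ1 : ρ = 1 := by
    have h1 := hzero 0
    simp only [χ] at h1
    rw [hψ0, hη0] at h1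
    have h2 : (1 - ρ) * (α * x 0 0) = 0 := by linarith
    rcases mul_eq_zero.1 h2 with h3 | h3
    · linarith
    · exact absurd h3 hpos0.ne'
  have h1 := hzero t
  simp only [χ, hρ1, ψ, η] at h1
  linarith

lemma deriv_mul_cosh (h : IsHomoclinic α c x) (h0 : x 1 0 = 0) (t : ℝ) :
    x 1 t * cosh t = -α * x 0 t * sinh t := by
  have h1 := h.twist_subD_eq_twist_addD h0 t
  rw [twist_subD_zero, twist_addD_zero, neg_one_mul, one_mul] at h1
  rw [cosh_eq, sinh_eq]
  linarith

theorem unique {y : ℕ → ℝ → ℝ} (hx : IsHomoclinic α c x) (hy : IsHomoclinic α c y)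
    (hx0 : x 1 0 = 0) (hy0 : y 1 0 = 0) : x 0 = y 0 := by
  have hα := hx.alpha_pos
  have hd : ∀ t, HasDerivAt (fun t => x 0 t / y 0 t) 0 t := by
    intro t
    refine ((hx.tower 0 t).div (hy.tower 0 t) (hy.pos t).ne').congr_deriv ?_
    have h1 := hx.deriv_mul_cosh hx0 t
    have h2 := hy.deriv_mul_cosh hy0 t
    have h3 : (x 1 t * y 0 t - x 0 t * y 1 t) * cosh t = 0 := by
      linear_combination y 0 t * h1 - x 0 t * h2
    rw [(mul_eq_zero.1 h3).resolve_right (cosh_pos t).ne', zero_div]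
  set r := x 0 0 / y 0 0
  have hr : 0 < r := div_pos (hx.pos 0) (hy.pos 0)
  have hconst : ∀ t, x 0 t = r * y 0 t := by
    intro t
    have := is_const_of_deriv_eq_zero (fun t => (hd t).differentiableAt) (fun t => (hd t).deriv) t 0
    exact (div_eq_iff (hy.pos t).ne').1 this
  have hall : ∀ k t, x k t = r * y k t := by
    intro k
    induction k with
    | zero => exact hconst
    | succ k ih =>
      intro t
      have h1 := hx.tower k t
      rw [funext ih] at h1
      exact h1.unique ((hy.tower k t).const_mul r)
  have h1 := hx.eq 0
  have h2 := hy.eq 0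
  have e : helm (α + 4) (helm (α + 2) (helm α x)) 0 0 =
      r * helm (α + 4) (helm (α + 2) (helm α y)) 0 0 := by
    simp only [helm, hall]; ring
  rw [e, h2, hconst 0, mul_rpow hr.le (hy.pos 0).le] at h1
  have hpos : 0 < c * r * y 0 0 ^ (6 / α) * y 0 0 := by
    have := hy.pos 0
    have := hx.c_pos
    positivity
  have h3 : r ^ (6 / α) = 1 := by
    have : (r ^ (6 / α) - 1) * (c * r * y 0 0 ^ (6 / α) * y 0 0) = 0 := by
      linear_combination -h1
    linarith [(mul_eq_zero.1 this).resolve_right hpos.ne']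
  have h4 : r = 1 :=
    (rpow_left_inj hr.le zero_le_one (by positivity : (6 / α) ≠ 0)).1 (by rw [h3, one_rpow])
  funext t
  rw [hconst t, h4, one_mul]

end IsHomoclinic

lemma contDiff_of_contDiff_iteratedDeriv {v : ℝ → ℝ} {k m : ℕ} (hv : ContDiff ℝ k v)
    (h : ContDiff ℝ m (iteratedDeriv k v)) : ContDiff ℝ ((m + k : ℕ) : WithTop ℕ∞) v := by
  induction k generalizing m with
  | zero => simpa using h
  | succ k ih =>
    have hk : ContDiff ℝ k v := hv.of_le (by exact_mod_cast Nat.le_succ k)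
    have h1 : ContDiff ℝ ((m + 1 : ℕ) : WithTop ℕ∞) (iteratedDeriv k v) := by
      rw [Nat.cast_add, Nat.cast_one, contDiff_succ_iff_deriv]
      refine ⟨hv.differentiable_iteratedDeriv k (by exact_mod_cast Nat.lt_succ_self k),
        by simp, ?_⟩
      rwa [← iteratedDeriv_succ]
    have := ih hk h1
    rwa [show m + 1 + k = m + (k + 1) by ring] at this

lemma IsSolO6.contDiff_nat {n : ℕ} {v : ℝ → ℝ} (hv : IsSolO6 n v) (hpos : ∀ t, 0 < v t) (m : ℕ) :
    ContDiff ℝ m v := by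
  suffices h : ContDiff ℝ ((m + 6 : ℕ) : WithTop ℕ∞) v from
    h.of_le (by exact_mod_cast Nat.le_add_right m 6)
  induction m with
  | zero => exact_mod_cast hv.1
  | succ m ih =>
    refine contDiff_of_contDiff_iteratedDeriv (by exact_mod_cast hv.1) ?_
    have hi : ∀ i ≤ 4, ContDiff ℝ ((m + 1 : ℕ) : WithTop ℕ∞) (iteratedDeriv i v) := by
      intro i hi
      rw [iteratedDeriv_eq_iterate]
      exact ContDiff.iterate_deriv' (m + 1) i
        (ih.of_le (by exact_mod_cast (by omega : m + 1 + i ≤ m + 6)))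
    have h0 : ContDiff ℝ ((m + 1 : ℕ) : WithTop ℕ∞) v := by simpa using hi 0 (by norm_num)
    have e : iteratedDeriv 6 v = fun t => K4 n * iteratedDeriv 4 v t - K2 n * iteratedDeriv 2 v t
        + K0 n * v t - cN n * v t ^ (12 / ((n : ℝ) - 6)) * v t := by
      funext t
      have := hv.2 t
      rw [abs_of_pos (hpos t)] at this
      linarith
    rw [e]
    refine (((contDiff_const.mul (hi 4 le_rfl)).sub (contDiff_const.mul (hi 2 (by norm_num)))).add
      (contDiff_const.mul h0)).sub ((contDiff_const.mul ?_).mul h0)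
    exact h0.rpow_const_of_ne fun t => (hpos t).ne'

lemma IsSolO6.isHomoclinic {n : ℕ} (hn : 7 ≤ n) {v : ℝ → ℝ} (hv : IsSolO6 n v)
    (hpos : ∀ t, 0 < v t) (hb : ∃ M : ℝ, ∀ t, |v t| ≤ M) (htop : Tendsto v atTop (nhds 0))
    (hbot : Tendsto v atBot (nhds 0)) :
    IsHomoclinic (((n : ℝ) - 6) / 2) (cN n) (fun k => iteratedDeriv k v) := by
  have hn' : (7 : ℝ) ≤ n := by exact_mod_cast hn
  have hα : 0 < ((n : ℝ) - 6) / 2 := by linarith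
  refine ⟨fun k t => ?_, hα, ?_, by simpa using hpos, ?_, by simpa using htop,
    by simpa using hbot, fun t => ?_⟩
  · rw [iteratedDeriv_succ]
    exact ((hv.contDiff_nat hpos (k + 1)).differentiable_iteratedDeriv k
      (by exact_mod_cast Nat.lt_succ_self k) t).hasDerivAt
  · have h1 : (n : ℝ) ^ 4 - 20 * (n : ℝ) ^ 2 + 64 = ((n : ℝ) ^ 2 - 4) * ((n : ℝ) ^ 2 - 16) := by
      ring
    have h2 : 0 < (n : ℝ) ^ 2 - 4 := by nlinarith
    have h3 : 0 < (n : ℝ) ^ 2 - 16 := by nlinarith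
    have h4 : 0 < (n : ℝ) - 6 := by linarith
    rw [cN, h1]
    positivity
  · obtain ⟨M, hM⟩ := hb
    exact ⟨M, fun t => by simpa using (le_abs_self _).trans (hM t)⟩
  · have h := hv.2 t
    rw [abs_of_pos (hpos t)] at h
    have e : 6 / (((n : ℝ) - 6) / 2) = 12 / ((n : ℝ) - 6) := by
      have : (n : ℝ) - 6 ≠ 0 := by linarith
      field_simp
      norm_num
    rw [e]
    simp only [helm, iteratedDeriv_zero, zero_add, Nat.reduceAdd]
    simp only [K4, K2, K0] at h
    linear_combination -h

theorem uniqueness_of_homoclinic_solutions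
    (n : ℕ) (hn : 7 ≤ n) (v₁ v₂ : ℝ → ℝ)
    (hv₁ : IsSolO6 n v₁) (hv₂ : IsSolO6 n v₂)
    (hb₁ : ∃ M : ℝ, ∀ t : ℝ, |v₁ t| ≤ M) (hb₂ : ∃ M : ℝ, ∀ t : ℝ, |v₂ t| ≤ M)
    (hpos₁ : ∀ t : ℝ, 0 < v₁ t) (hpos₂ : ∀ t : ℝ, 0 < v₂ t)
    (hlim₁ : Tendsto v₁ atTop (nhds 0) ∧ Tendsto v₁ atBot (nhds 0))
    (hlim₂ : Tendsto v₂ atTop (nhds 0) ∧ Tendsto v₂ atBot (nhds 0))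
    (hd₁ : deriv v₁ 0 = 0) (hd₂ : deriv v₂ 0 = 0) :
    ∀ t : ℝ, v₁ t = v₂ t := by
  have h := IsHomoclinic.unique (hv₁.isHomoclinic hn hpos₁ hb₁ hlim₁.1 hlim₁.2)
    (hv₂.isHomoclinic hn hpos₂ hb₂ hlim₂.1 hlim₂.2) (by simpa using hd₁) (by simpa using hd₂)
  simp only [iteratedDeriv_zero] at h
  exact congrFun h
end
end
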